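/- arXiv:1009.6152 — 2 statements merged into one kernel-verified Lean document; each statement's English description precedes it below -/
import Mathlib

section
/- Let $a > 0$ and let $q : [0,a] \to \mathbb{R}$ be continuous. For a continuous function $p : [0,a] \to \mathbb{R}$, call $\lambda \in \mathbb{R}$ a Neumann eigenvalue for potential $p$ if there exists a twice continuously differentiable function $y : [0,a] \to \mathbb{R}$, not identically zero, with $-y''(x) + p(x) y(x) = \lambda y(x)$ for all $x \in [0,a]$, $y'(0) = 0$ and $y'(a) = 0$. If the set of Neumann eigenvalues for $q$ equals the set of Neumann eigenvalues for the zero potential (which is $\{ (n\pi/a)^2 : n = 0, 1, 2, \dots \}$), then $q(x) = 0$ for all $x \in [0,a]$. -/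
/-- `lam` is a Neumann eigenvalue for the potential `p` on `[0,a]`:
there is a twice continuously differentiable function `y` on `[0,a]`,
not identically zero, with `-y'' + p y = lam y`, `y'(0) = 0`, `y'(a) = 0`. -/
def IsNeumannEigenvalue (a : ℝ) (p : ℝ → ℝ) (lam : ℝ) : Prop :=
  ∃ y y' y'' : ℝ → ℝ,
    (∀ x ∈ Set.Icc (0 : ℝ) a, HasDerivAt y (y' x) x) ∧
    (∀ x ∈ Set.Icc (0 : ℝ) a, HasDerivAt y' (y'' x) x) ∧
    ContinuousOn y'' (Set.Icc 0 a) ∧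
    (∃ x ∈ Set.Icc (0 : ℝ) a, y x ≠ 0) ∧
    (∀ x ∈ Set.Icc (0 : ℝ) a, -y'' x + p x * y x = lam * y x) ∧
    y' 0 = 0 ∧ y' a = 0

open Set Filter Topology NNReal

theorem exists_hasDerivAt_Icc_of_lipschitz_of_bounded {f : ℝ → ℝ → ℝ} {K L : ℝ≥0}
    (hlip : ∀ t, LipschitzWith K (f t)) (hcont : ∀ x, Continuous (f · x))
    (hbound : ∀ t x, ‖f t x‖ ≤ L) {a : ℝ} (ha : 0 ≤ a) :
    ∃ v : ℝ → ℝ, v 0 = 0 ∧ ∀ t ∈ Icc 0 a, HasDerivAt v (f t (v t)) t := by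
  have h0 : (0 : ℝ) ∈ Icc (-1) (a + 1) := ⟨by norm_num, by linarith⟩
  have hpl : IsPicardLindelof f (⟨0, h0⟩ : Icc (-1 : ℝ) (a + 1)) 0
      (L * ⟨a + 1, by linarith⟩) 0 L K :=
    { lipschitzOnWith := fun t _ ↦ (hlip t).lipschitzOnWith
      continuousOn := fun x _ ↦ (hcont x).continuousOn
      norm_le := fun t _ x _ ↦ hbound t x
      mul_max_le := by
        have : max (a + 1 - 0) (0 - (-1 : ℝ)) = a + 1 := by
          rw [sub_zero]; exact max_eq_left (by linarith)
        rw [this, NNReal.coe_zero, sub_zero]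
        exact le_rfl }
  obtain ⟨v, hv0, hv⟩ := hpl.exists_eq_forall_mem_Icc_hasDerivWithinAt₀
  exact ⟨v, hv0, fun t ht ↦ (hv t ⟨by linarith [ht.1], by linarith [ht.2]⟩).hasDerivAt
    (Icc_mem_nhds (by linarith [ht.1]) (by linarith [ht.2]))⟩

/-- The endpoint of the solution of `v' = g t v - lam`, `v 0 = 0` is Lipschitz in `lam`. -/
theorem abs_sub_le_of_hasDerivAt_sub_const {g : ℝ → ℝ → ℝ} {K : ℝ≥0} (hK : K ≠ 0)
    (hlip : ∀ t, LipschitzWith K (g t)) {a : ℝ} (ha : 0 ≤ a) {v w : ℝ → ℝ} {lam mu : ℝ}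
    (hv0 : v 0 = 0) (hw0 : w 0 = 0)
    (hv : ∀ t ∈ Icc 0 a, HasDerivAt v (g t (v t) - lam) t)
    (hw : ∀ t ∈ Icc 0 a, HasDerivAt w (g t (w t) - mu) t) :
    |v a - w a| ≤ (Real.exp (K * a) - 1) / K * |lam - mu| := by
  have hd : ∀ t ∈ Icc 0 a, HasDerivAt (fun s ↦ v s - w s)
      ((g t (v t) - lam) - (g t (w t) - mu)) t := fun t ht ↦ (hv t ht).sub (hw t ht)
  have key := norm_le_gronwallBound_of_norm_deriv_right_le (δ := 0) (K := K) (ε := |lam - mu|)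
    (HasDerivAt.continuousOn hd)
    (fun t ht ↦ (hd t (Ico_subset_Icc_self ht)).hasDerivWithinAt) (by simp [hv0, hw0])
    (fun t _ ↦ by
      have h1 := (hlip t).dist_le_mul (v t) (w t)
      rw [Real.dist_eq, Real.dist_eq] at h1
      calc ‖(g t (v t) - lam) - (g t (w t) - mu)‖
          = |(g t (v t) - g t (w t)) - (lam - mu)| := by rw [Real.norm_eq_abs]; congr 1; ring
        _ ≤ |g t (v t) - g t (w t)| + |lam - mu| := abs_sub _ _
        _ ≤ K * ‖v t - w t‖ + |lam - mu| := by gcongr; exact h1) a ⟨ha, le_rfl⟩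
  rw [gronwallBound_of_K_ne_0 (by exact_mod_cast hK)] at key
  simp only [zero_mul, zero_add, sub_zero, Real.norm_eq_abs] at key
  exact key.trans_eq (by ring)

/-- The square function truncated outside `[-M, M]`. -/
noncomputable def truncSq (M x : ℝ) : ℝ := (max (-M) (min x M)) ^ 2

theorem truncSq_nonneg (M x : ℝ) : 0 ≤ truncSq M x := sq_nonneg _

theorem truncSq_le {M : ℝ} (hM : 0 ≤ M) (x : ℝ) : truncSq M x ≤ M ^ 2 :=
  sq_le_sq' (le_max_left _ _) (max_le (by linarith) (min_le_right _ _))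

theorem truncSq_of_abs_le {M x : ℝ} (h : |x| ≤ M) : truncSq M x = x ^ 2 := by
  rw [truncSq, min_eq_left (abs_le.1 h).2, max_eq_right (abs_le.1 h).1]

theorem truncSq_of_le_abs {M x : ℝ} (hM : 0 ≤ M) (h : M ≤ |x|) : truncSq M x = M ^ 2 := by
  rcases le_abs.1 h with h | h
  · rw [truncSq, min_eq_right h, max_eq_right (by linarith)]
  · rw [truncSq, min_eq_left (by linarith), max_eq_left (by linarith), neg_sq]

theorem lipschitzWith_truncSq (M : ℝ≥0) : LipschitzWith (2 * M) (truncSq M) := by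
  refine LipschitzWith.of_dist_le_mul fun x y ↦ ?_
  have hclamp : LipschitzWith 1 (fun x : ℝ ↦ max (-(M : ℝ)) (min x M)) :=
    (LipschitzWith.id.min_const (M : ℝ)).const_max _
  have h1 := hclamp.dist_le_mul x y
  have hM : (-(M : ℝ)) ≤ M := by linarith [M.coe_nonneg]
  have hb : ∀ x : ℝ, |max (-(M : ℝ)) (min x M)| ≤ M := fun x ↦
    abs_le.2 ⟨le_max_left _ _, max_le hM (min_le_right _ _)⟩
  simp only [Real.dist_eq, truncSq, NNReal.coe_one, one_mul, sq_sub_sq, abs_mul] at h1 ⊢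
  push_cast
  gcongr
  exact (abs_add_le _ _).trans (by linarith [hb x, hb y])

/-- A function with zero boundary values whose derivative does not vanish where `M < |v|`
is bounded by `M`. -/
theorem abs_le_of_hasDerivAt_ne_zero {a M : ℝ} (ha : 0 ≤ a) (hM : 0 ≤ M) {v v' : ℝ → ℝ}
    (hv : ∀ t ∈ Icc 0 a, HasDerivAt v (v' t) t) (hv0 : v 0 = 0) (hva : v a = 0)
    (hne : ∀ t ∈ Icc 0 a, M < |v t| → v' t ≠ 0) : ∀ t ∈ Icc 0 a, |v t| ≤ M := by
  obtain ⟨c, hc, hmax⟩ := isCompact_Icc.exists_isMaxOn (nonempty_Icc.2 ha)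
    (HasDerivAt.continuousOn hv)
  obtain ⟨d, hd, hmin⟩ := isCompact_Icc.exists_isMinOn (nonempty_Icc.2 ha)
    (HasDerivAt.continuousOn hv)
  have interior : ∀ c ∈ Icc 0 a, M < |v c| → Icc 0 a ∈ 𝓝 c := fun c hc h ↦ by
    refine Icc_mem_nhds (hc.1.lt_of_ne ?_) (hc.2.lt_of_ne ?_)
    · rintro rfl; rw [hv0, abs_zero] at h; linarith
    · rintro rfl; rw [hva, abs_zero] at h; linarith
  have hcM : |v c| ≤ M := by
    by_contra! h
    exact hne c hc h ((hmax.isLocalMax (interior c hc h)).hasDerivAt_eq_zero (hv c hc))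
  have hdM : |v d| ≤ M := by
    by_contra! h
    exact hne d hd h ((hmin.isLocalMin (interior d hd h)).hasDerivAt_eq_zero (hv d hd))
  intro t ht
  exact abs_le.2 ⟨(abs_le.1 hdM).1.trans (hmin ht), (hmax ht : v t ≤ v c).trans (abs_le.1 hcM).2⟩

/-- For some spectral parameter the Riccati equation has a solution vanishing at both ends. -/
theorem exists_riccati_solution {a : ℝ} (ha : 0 < a) {q : ℝ → ℝ} (hq : Continuous q) {Q : ℝ}
    (hQ : ∀ x, |q x| ≤ Q) :
    ∃ (lam : ℝ) (v : ℝ → ℝ), v 0 = 0 ∧ v a = 0 ∧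
      ∀ t ∈ Icc 0 a, HasDerivAt v (q t - lam - v t ^ 2) t := by
  have hQ0 : 0 ≤ Q := (abs_nonneg _).trans (hQ 0)
  obtain ⟨M, hM⟩ : ∃ M : ℝ≥0, (M : ℝ) = 2 * Q + 2 := ⟨⟨2 * Q + 2, by linarith⟩, rfl⟩
  have hK : 2 * M ≠ 0 := by
    intro h
    have : (2 * M : ℝ) = 0 := by exact_mod_cast h
    linarith
  have hlip : ∀ t, LipschitzWith (2 * M) (fun x ↦ q t - truncSq M x) := fun t ↦
    LipschitzWith.of_dist_le_mul fun x y ↦ by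
      rw [dist_sub_left]; exact (lipschitzWith_truncSq M).dist_le_mul x y
  have hex : ∀ lam : ℝ, ∃ v : ℝ → ℝ, v 0 = 0 ∧
      ∀ t ∈ Icc 0 a, HasDerivAt v (q t - truncSq M (v t) - lam) t := fun lam ↦ by
    refine exists_hasDerivAt_Icc_of_lipschitz_of_bounded (K := 2 * M)
      (f := fun t x ↦ q t - truncSq M x - lam)
      (L := ⟨Q + M ^ 2 + |lam|, by positivity⟩) (fun t ↦ ?_) (fun x ↦ by fun_prop)
      (fun t x ↦ ?_) ha.le
    · exact LipschitzWith.of_dist_le_mul fun x y ↦ by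
        rw [dist_sub_right]; exact (hlip t).dist_le_mul x y
    · change |_| ≤ Q + M ^ 2 + |lam|
      refine (abs_sub _ _).trans (add_le_add_left ((abs_sub _ _).trans (add_le_add (hQ t) ?_)) _)
      rw [abs_of_nonneg (truncSq_nonneg _ _)]
      exact truncSq_le M.2 x
  choose v hv0 hv using hex
  have hcont : Continuous fun lam ↦ v lam a := by
    refine (LipschitzWith.of_dist_le_mul
      (K := ⟨(Real.exp ((2 * M : ℝ≥0) * a) - 1) / (2 * M : ℝ≥0), ?_⟩) fun lam mu ↦ ?_).continuous
    · exact div_nonneg (sub_nonneg.2 (Real.one_le_exp (by positivity)))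
        (NNReal.coe_nonneg _)
    · exact abs_sub_le_of_hasDerivAt_sub_const hK hlip ha.le (hv0 _) (hv0 _) (hv lam) (hv mu)
  have hcv : ∀ lam, ContinuousOn (v lam) (Icc 0 a) := fun lam ↦ HasDerivAt.continuousOn (hv lam)
  have hlow : 0 ≤ v (-Q - 1) a := by
    have := image_le_of_deriv_right_lt_deriv_boundary (B := fun _ ↦ 0) (B' := fun _ ↦ 0)
      (hcv (-Q - 1)).neg
      (fun t ht ↦ ((hv (-Q - 1) t (Ico_subset_Icc_self ht)).neg).hasDerivWithinAt)
      (by simp [hv0]) (fun x ↦ hasDerivAt_const x 0) (fun t _ h ↦ by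
        have h : v (-Q - 1) t = 0 := by simpa using h
        rw [h, truncSq_of_abs_le (by simp)]
        linarith [(abs_le.1 (hQ t)).1]) ⟨ha.le, le_rfl⟩
    simpa using this
  have hhigh : v Q a ≤ 0 := by
    rw [← hv0 Q]
    refine antitoneOn_of_deriv_nonpos (convex_Icc 0 a) (hcv Q)
      (fun t ht ↦ (hv Q t (interior_subset ht)).differentiableAt.differentiableWithinAt)
      (fun t ht ↦ ?_) ⟨le_rfl, ha.le⟩ ⟨ha.le, le_rfl⟩ ha.le
    rw [(hv Q t (interior_subset ht)).deriv]
    linarith [(abs_le.1 (hQ t)).2, truncSq_nonneg M (v Q t)]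
  obtain ⟨lam, ⟨hl1, hl2⟩, hlam⟩ := intermediate_value_Icc' (show -Q - 1 ≤ Q by linarith)
    hcont.continuousOn ⟨hhigh, hlow⟩
  have hbd := abs_le_of_hasDerivAt_ne_zero ha.le M.2 (hv lam) (hv0 lam) hlam fun t _ h ↦ by
    have : truncSq M (v lam t) = M ^ 2 := truncSq_of_le_abs M.2 h.le
    rw [this, hM]
    nlinarith [(abs_le.1 (hQ t)).2]
  refine ⟨lam, v lam, hv0 lam, hlam, fun t ht ↦ (hv lam t ht).congr_deriv ?_⟩
  have : truncSq M (v lam t) = v lam t ^ 2 := truncSq_of_abs_le (hbd t ht)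
  rw [this]
  ring

/-- A solution of the Riccati equation vanishing at both ends gives a positive eigenfunction. -/
theorem IsNeumannEigenvalue.of_riccati {a : ℝ} (ha : 0 ≤ a) {q v : ℝ → ℝ} {lam : ℝ}
    (hq : ContinuousOn q (Icc 0 a)) (hv0 : v 0 = 0) (hva : v a = 0)
    (hv : ∀ t ∈ Icc 0 a, HasDerivAt v (q t - lam - v t ^ 2) t) :
    IsNeumannEigenvalue a q lam := by
  have hcv : ContinuousOn v (Icc 0 a) := HasDerivAt.continuousOn hv
  set w := IccExtend ha ((Icc 0 a).domRestrict v) with hw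
  have hcw : Continuous w := (continuousOn_iff_continuous_domRestrict.1 hcv).Icc_extend'
  have hwv : ∀ x ∈ Icc 0 a, w x = v x := fun x hx ↦ by
    rw [hw, IccExtend_of_mem _ _ hx, domRestrict_apply]
  set y : ℝ → ℝ := fun x ↦ Real.exp (∫ t in (0 : ℝ)..x, w t)
  have hy : ∀ x ∈ Icc 0 a, HasDerivAt y (v x * y x) x := fun x hx ↦ by
    have := (intervalIntegral.integral_hasDerivAt_right (hcw.intervalIntegrable 0 x)
      (hcw.stronglyMeasurableAtFilter _ _) hcw.continuousAt).exp
    rwa [hwv x hx, mul_comm] at this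
  refine ⟨y, fun x ↦ v x * y x, fun x ↦ (q x - lam) * y x, hy, fun x hx ↦ ?_, ?_, ?_, ?_, ?_, ?_⟩
  · exact ((hv x hx).mul (hy x hx)).congr_deriv (by ring)
  · exact (hq.sub continuousOn_const).mul (HasDerivAt.continuousOn hy)
  · exact ⟨0, ⟨le_rfl, ha⟩, (Real.exp_pos _).ne'⟩
  · intro x _; ring
  · simp [hv0]
  · simp [hva]

theorem IsNeumannEigenvalue.nonneg_of_zero_potential {a : ℝ} (ha : 0 < a) {lam : ℝ}
    (h : IsNeumannEigenvalue a (fun _ ↦ 0) lam) : 0 ≤ lam := by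
  obtain ⟨y, y', y'', hy, hy', -, ⟨c, hc, hyc⟩, heq, h0, ha'⟩ := h
  by_contra! hlam
  have hcy := HasDerivAt.continuousOn hy
  have hcy' := HasDerivAt.continuousOn hy'
  have hcont : ContinuousOn (fun x ↦ y' x ^ 2 - lam * y x ^ 2) (Icc 0 a) := by fun_prop
  have hint : ∫ x in (0 : ℝ)..a, (y' x ^ 2 - lam * y x ^ 2) = y a * y' a - y 0 * y' 0 := by
    refine intervalIntegral.integral_eq_sub_of_hasDerivAt (f := fun x ↦ y x * y' x) (fun x hx ↦ ?_)
      (hcont.intervalIntegrable_of_Icc ha.le)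
    rw [uIcc_of_le ha.le] at hx
    refine ((hy x hx).mul (hy' x hx)).congr_deriv ?_
    linear_combination -y x * heq x hx
  have hpos := intervalIntegral.integral_pos ha hcont
    (fun x _ ↦ by nlinarith [sq_nonneg (y' x), sq_nonneg (y x)])
    ⟨c, hc, by nlinarith [sq_nonneg (y' c), pow_pos (abs_pos.2 hyc) 2, sq_abs (y c)]⟩
  simp [hint, h0, ha'] at hpos

theorem isNeumannEigenvalue_zero_potential {a k : ℝ} (ha : 0 ≤ a) (hk : Real.sin (k * a) = 0) :
    IsNeumannEigenvalue a (fun _ ↦ 0) (k ^ 2) := by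
  have hl : ∀ x : ℝ, HasDerivAt (fun x ↦ k * x) k x := fun x ↦ by
    simpa using (hasDerivAt_id x).const_mul k
  refine ⟨fun x ↦ Real.cos (k * x), fun x ↦ -Real.sin (k * x) * k,
    fun x ↦ -(Real.cos (k * x) * k) * k, fun x _ ↦ (hl x).cos, fun x _ ↦ (hl x).sin.neg.mul_const k,
    by fun_prop, ⟨0, ⟨le_rfl, ha⟩, by simp⟩, fun x _ ↦ by ring, by simp, by simp [hk]⟩

/-- A solution of `-y'' + q y = k ^ 2 y` with `y' 0 = 0` is close to `y 0 * cos (k x)`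
for large `k`. -/
theorem abs_sub_mul_cos_le {a k Q : ℝ} (hk : 0 < k) (hQ : 0 < Q) {q y y' y'' : ℝ → ℝ}
    (hqQ : ∀ x ∈ Icc 0 a, |q x| ≤ Q)
    (hy : ∀ x ∈ Icc 0 a, HasDerivAt y (y' x) x) (hy' : ∀ x ∈ Icc 0 a, HasDerivAt y' (y'' x) x)
    (heq : ∀ x ∈ Icc 0 a, -y'' x + q x * y x = k ^ 2 * y x) (h0 : y' 0 = 0) :
    ∀ x ∈ Icc 0 a, |y x - y 0 * Real.cos (k * x)| ≤ |y 0| * (Real.exp (Q / k * a) - 1) := by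
  have hkC : (k : ℂ) ≠ 0 := by exact_mod_cast hk.ne'
  set e : ℝ → ℂ := fun x ↦ Complex.exp (((-k * x : ℝ) : ℂ) * Complex.I) with he
  have hnorm : ∀ x, ‖e x‖ = 1 := fun x ↦ Complex.norm_exp_ofReal_mul_I _
  set z : ℝ → ℂ := fun x ↦ (y x : ℂ) - Complex.I * (y' x : ℂ) / k with hz
  have hde : ∀ x, HasDerivAt e (-(k * Complex.I) * e x) x := fun x ↦ by
    have h1 : HasDerivAt (fun x : ℝ ↦ -k * x) (-k) x := by
      simpa using (hasDerivAt_id x).const_mul (-k)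
    refine (h1.ofReal_comp.mul_const Complex.I).cexp.congr_deriv ?_
    simp only [he]; push_cast; ring
  have hyz : ∀ x, |y x| ≤ ‖z x‖ := fun x ↦ by
    have : (z x).re = y x := by simp [hz, Complex.div_ofReal_re]
    rw [← this]; exact Complex.abs_re_le_norm _
  have hdW : ∀ x ∈ Icc 0 a, HasDerivAt (fun x ↦ e x * z x - y 0)
      (-(Complex.I * q x * y x / k) * e x) x := fun x hx ↦ by
    have h1 : HasDerivAt z (y' x - Complex.I * y'' x / k) x :=
      (hy x hx).ofReal_comp.sub (((hy' x hx).ofReal_comp.const_mul Complex.I).div_const _)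
    have h2 : (y'' x : ℂ) = q x * y x - k ^ 2 * y x := by
      have : y'' x = q x * y x - k ^ 2 * y x := by linarith [heq x hx]
      rw [this]; push_cast; ring
    refine (((hde x).mul h1).sub_const _).congr_deriv ?_
    simp only [hz]
    rw [h2]
    field_simp
    ring_nf
    simp only [Complex.I_sq]
    ring
  intro x hx
  have key := norm_le_gronwallBound_of_norm_deriv_right_le (δ := 0) (K := Q / k)
    (ε := Q / k * |y 0|) (HasDerivAt.continuousOn hdW)
    (fun t ht ↦ (hdW t (Ico_subset_Icc_self ht)).hasDerivWithinAt)
    (by simp [he, hz, h0])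
    (fun t ht ↦ by
      have h1 : ‖z t‖ ≤ ‖e t * z t - y 0‖ + |y 0| := by
        have := norm_add_le (e t * z t - y 0) (y 0 : ℂ)
        rwa [sub_add_cancel, norm_mul, hnorm, one_mul, Complex.norm_real, Real.norm_eq_abs] at this
      rw [norm_mul, hnorm, norm_neg, norm_div, norm_mul, norm_mul]
      simp only [Complex.norm_I, Complex.norm_real, Real.norm_eq_abs, one_mul, mul_one]
      rw [abs_of_pos hk, mul_div_right_comm, ← mul_add]
      have := hqQ t (Ico_subset_Icc_self ht)
      have := (hyz t).trans h1
      gcongr) x hx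
  rw [gronwallBound_of_K_ne_0 (by positivity)] at key
  have hre : y x - y 0 * Real.cos (k * x)
      = (Complex.exp (((k * x : ℝ) : ℂ) * Complex.I) * (e x * z x - y 0)).re := by
    have h1 : Complex.exp (((k * x : ℝ) : ℂ) * Complex.I) * e x = 1 := by
      rw [he, ← Complex.exp_add]; push_cast; ring_nf; simp
    rw [mul_sub, ← mul_assoc, h1, one_mul, Complex.sub_re, Complex.re_mul_ofReal,
      Complex.exp_ofReal_mul_I_re]
    simp [hz, Complex.div_ofReal_re, mul_comm]
  calc |y x - y 0 * Real.cos (k * x)| ≤ ‖e x * z x - y 0‖ := by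
        rw [hre]
        refine (Complex.abs_re_le_norm _).trans_eq ?_
        rw [norm_mul, Complex.norm_exp_ofReal_mul_I, one_mul]
    _ ≤ |y 0| * (Real.exp (Q / k * x) - 1) := key.trans_eq (by field_simp; ring_nf)
    _ ≤ |y 0| * (Real.exp (Q / k * a) - 1) := by gcongr; exact hx.2

theorem IsNeumannEigenvalue.abs_integral_mul_cos_sq_le {a k Q : ℝ} (ha : 0 < a) (hk : 0 < k)
    (hQ : 0 < Q) {q : ℝ → ℝ} (hq : ContinuousOn q (Icc 0 a)) (hqQ : ∀ x ∈ Icc 0 a, |q x| ≤ Q)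
    (hka : Real.sin (k * a) = 0) (h : IsNeumannEigenvalue a q (k ^ 2)) :
    |∫ x in (0 : ℝ)..a, q x * Real.cos (k * x) ^ 2| ≤ Q * (Real.exp (Q / k * a) - 1) * a := by
  obtain ⟨y, y', y'', hy, hy', -, ⟨c, hc, hyc⟩, heq, h0, ha'⟩ := h
  have hclose := abs_sub_mul_cos_le hk hQ hqQ hy hy' heq h0
  have hy0 : y 0 ≠ 0 := fun h ↦ hyc (by simpa [h] using hclose c hc)
  have hcy := HasDerivAt.continuousOn hy
  have hl : ∀ x : ℝ, HasDerivAt (fun x ↦ k * x) k x := fun x ↦ by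
    simpa using (hasDerivAt_id x).const_mul k
  have hcint : ContinuousOn (fun x ↦ q x * y x * Real.cos (k * x)) (Icc 0 a) := by fun_prop
  have horth : ∫ x in (0 : ℝ)..a, q x * y x * Real.cos (k * x) = 0 := by
    rw [intervalIntegral.integral_eq_sub_of_hasDerivAt
      (f := fun x ↦ y' x * Real.cos (k * x) + y x * (Real.sin (k * x) * k)) (fun x hx ↦ ?_)
      (hcint.intervalIntegrable_of_Icc ha.le)]
    · simp [h0, ha', hka]
    · rw [uIcc_of_le ha.le] at hx
      refine (((hy' x hx).mul (hl x).cos).add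
        ((hy x hx).mul ((hl x).sin.mul_const k))).congr_deriv ?_
      linear_combination -Real.cos (k * x) * heq x hx
  have hcint' : ContinuousOn (fun x ↦ q x * Real.cos (k * x) ^ 2) (Icc 0 a) := by fun_prop
  have hsplit : ∫ x in (0 : ℝ)..a, q x * Real.cos (k * x) ^ 2
      = ∫ x in (0 : ℝ)..a, (q x * Real.cos (k * x) ^ 2
        - (y 0)⁻¹ * (q x * y x * Real.cos (k * x))) := by
    rw [intervalIntegral.integral_sub (hcint'.intervalIntegrable_of_Icc ha.le)
      ((hcint.intervalIntegrable_of_Icc ha.le).const_mul _), intervalIntegral.integral_const_mul,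
      horth, mul_zero, sub_zero]
  rw [hsplit, ← Real.norm_eq_abs]
  refine (intervalIntegral.norm_integral_le_of_norm_le_const (C := Q * (Real.exp (Q / k * a) - 1))
    fun x hx ↦ ?_).trans_eq (by rw [sub_zero, abs_of_pos ha])
  rw [uIoc_of_le ha.le] at hx
  replace hx := Ioc_subset_Icc_self hx
  have h1 : q x * Real.cos (k * x) ^ 2 - (y 0)⁻¹ * (q x * y x * Real.cos (k * x))
      = -(q x * ((y 0)⁻¹ * (y x - y 0 * Real.cos (k * x))) * Real.cos (k * x)) := by
    field_simp; ring
  have h2 : |(y 0)⁻¹ * (y x - y 0 * Real.cos (k * x))| ≤ Real.exp (Q / k * a) - 1 := by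
    rw [abs_mul, abs_inv, inv_mul_le_iff₀ (abs_pos.2 hy0)]
    exact hclose x hx
  rw [h1, Real.norm_eq_abs, abs_neg, abs_mul, abs_mul]
  refine (mul_le_of_le_one_right (by positivity) (Real.abs_cos_le_one _)).trans ?_
  gcongr
  exact hqQ x hx

theorem tendsto_integral_mul_cos_two_mul {a : ℝ} (ha : 0 < a) {q : ℝ → ℝ}
    (hq : ContinuousOn q (Icc 0 a)) :
    Tendsto (fun n : ℕ ↦ ∫ x in (0 : ℝ)..a, q x * Real.cos (2 * (n * Real.pi / a * x))) atTop
      (𝓝 0) := by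
  have hw : Tendsto (fun n : ℕ ↦ (n : ℝ) / a) atTop (cocompact ℝ) :=
    (tendsto_natCast_atTop_atTop.atTop_div_const ha).mono_right atTop_le_cocompact
  have h := (Complex.continuous_re.tendsto 0).comp
    ((Real.tendsto_integral_exp_smul_cocompact
      ((Ioc 0 a).indicator fun x ↦ (q x : ℂ))).comp hw)
  refine h.congr fun n ↦ ?_
  have hind : ∀ v : ℝ, Real.fourierChar (-(v * (n / a))) • (Ioc 0 a).indicator (fun x ↦ (q x : ℂ)) v
      = (Ioc 0 a).indicator (fun x ↦ Real.fourierChar (-(x * (n / a))) • (q x : ℂ)) v := fun v ↦ by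
    by_cases hv : v ∈ Ioc 0 a <;> simp [hv]
  simp only [Function.comp_apply, hind]
  rw [MeasureTheory.integral_indicator measurableSet_Ioc, ← intervalIntegral.integral_of_le ha.le]
  have hci : IntervalIntegrable (fun x ↦ Real.fourierChar (-(x * (n / a))) • (q x : ℂ))
      MeasureTheory.volume 0 a := by
    refine ContinuousOn.intervalIntegrable_of_Icc ha.le ?_
    have : Continuous fun x : ℝ ↦ Real.fourierChar (-(x * (n / a))) :=
      Real.continuous_fourierChar.comp (by fun_prop)
    exact this.continuousOn.smul (Complex.continuous_ofReal.comp_continuousOn hq)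
  have := Complex.reCLM.intervalIntegral_comp_comm hci
  simp only [Complex.reCLM_apply] at this
  rw [← this]
  refine intervalIntegral.integral_congr fun x _ ↦ ?_
  simp only [Circle.smul_def, Real.fourierChar_apply, smul_eq_mul]
  rw [Complex.re_mul_ofReal, Complex.exp_ofReal_mul_I_re, mul_comm, ← Real.cos_neg]
  congr 2
  ring

theorem integral_eq_zero_of_isNeumannEigenvalue {a : ℝ} (ha : 0 < a) {q : ℝ → ℝ}
    (hq : ContinuousOn q (Icc 0 a))
    (h : ∀ n : ℕ, IsNeumannEigenvalue a q ((n * Real.pi / a) ^ 2)) :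
    ∫ x in (0 : ℝ)..a, q x = 0 := by
  obtain ⟨C, hC⟩ := isCompact_Icc.exists_bound_of_continuousOn hq
  set Q := max C 1
  have hQ : 0 < Q := lt_max_of_lt_right one_pos
  have hqQ : ∀ x ∈ Icc 0 a, |q x| ≤ Q := fun x hx ↦ (hC x hx).trans (le_max_left _ _)
  have hkt : Tendsto (fun n : ℕ ↦ n * Real.pi / a) atTop atTop :=
    (tendsto_natCast_atTop_atTop.atTop_mul_const Real.pi_pos).atTop_div_const ha
  have hbound : Tendsto (fun n : ℕ ↦ Q * (Real.exp (Q / (n * Real.pi / a) * a) - 1) * a) atTop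
      (𝓝 0) := by
    have h1 : Tendsto (fun n : ℕ ↦ Q / (n * Real.pi / a) * a) atTop (𝓝 0) := by
      simpa using (hkt.const_div_atTop Q).mul_const a
    simpa using ((((Real.continuous_exp.tendsto 0).comp h1).sub_const 1).const_mul Q).mul_const a
  have hsq : Tendsto (fun n : ℕ ↦ ∫ x in (0 : ℝ)..a, q x * Real.cos (n * Real.pi / a * x) ^ 2) atTop
      (𝓝 0) := by
    refine squeeze_zero_norm' ?_ hbound
    filter_upwards [eventually_gt_atTop 0] with n hn
    have hn' : (0 : ℝ) < n := by exact_mod_cast hn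
    exact (h n).abs_integral_mul_cos_sq_le ha (by positivity) hQ hq hqQ
      (by rw [div_mul_cancel₀ _ ha.ne']; exact Real.sin_nat_mul_pi n)
  have hlim := (hsq.const_mul 2).sub (tendsto_integral_mul_cos_two_mul ha hq)
  rw [mul_zero, sub_zero] at hlim
  refine tendsto_nhds_unique (tendsto_const_nhds.congr fun n ↦ ?_) hlim
  rw [← intervalIntegral.integral_const_mul, ← intervalIntegral.integral_sub]
  · refine intervalIntegral.integral_congr fun x _ ↦ ?_
    simp only [Real.cos_two_mul]
    ring
  · exact ContinuousOn.intervalIntegrable_of_Icc ha.le (by fun_prop)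
  · exact ContinuousOn.intervalIntegrable_of_Icc ha.le (by fun_prop)

/-- A potential with zero mean admitting a Riccati solution with nonnegative spectral parameter
and zero boundary values vanishes. -/
theorem eq_zero_of_riccati {a : ℝ} (ha : 0 < a) {q v : ℝ → ℝ} {lam : ℝ} (hlam : 0 ≤ lam)
    (hq : ContinuousOn q (Icc 0 a)) (hint : ∫ x in (0 : ℝ)..a, q x = 0)
    (hv0 : v 0 = 0) (hva : v a = 0)
    (hv : ∀ t ∈ Icc 0 a, HasDerivAt v (q t - lam - v t ^ 2) t) : ∀ x ∈ Icc 0 a, q x = 0 := by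
  have hcv := HasDerivAt.continuousOn hv
  have hc : ContinuousOn (fun t ↦ lam + v t ^ 2) (Icc 0 a) := by fun_prop
  have hqc : ContinuousOn (fun t ↦ q t - (lam + v t ^ 2)) (Icc 0 a) := hq.sub hc
  have hFTC : ∫ t in (0 : ℝ)..a, (q t - (lam + v t ^ 2)) = 0 := by
    rw [intervalIntegral.integral_eq_sub_of_hasDerivAt (f := v) (fun t ht ↦ ?_)
      (hqc.intervalIntegrable_of_Icc ha.le), hv0, hva, sub_zero]
    rw [uIcc_of_le ha.le] at ht
    exact (hv t ht).congr_deriv (by ring)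
  rw [intervalIntegral.integral_sub (hq.intervalIntegrable_of_Icc ha.le)
    (hc.intervalIntegrable_of_Icc ha.le), hint, zero_sub, neg_eq_zero] at hFTC
  have hzero : ∀ t ∈ Icc 0 a, lam + v t ^ 2 = 0 := fun t ht ↦ by
    by_contra hne
    have := intervalIntegral.integral_pos ha hc (fun s _ ↦ by positivity)
      ⟨t, ht, lt_of_le_of_ne (by positivity) (Ne.symm hne)⟩
    exact this.ne' hFTC
  have hvz : ∀ t ∈ Icc 0 a, v t = 0 := fun t ht ↦
    pow_eq_zero_iff two_ne_zero |>.1 (by linarith [hzero t ht, sq_nonneg (v t)])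
  intro x hx
  have h1 : HasDerivWithinAt v 0 (Icc 0 a) x :=
    (hasDerivWithinAt_const x (Icc 0 a) (0 : ℝ)).congr hvz (hvz x hx)
  have h2 := (uniqueDiffOn_Icc ha x hx).eq_deriv _ (hv x hx).hasDerivWithinAt h1
  linarith [hzero x hx]

/-- Ambarzumyan's theorem (1929): if the Neumann spectrum of `-y'' + q y` on
`[0,a]` coincides with the Neumann spectrum of the zero potential, then `q`
vanishes on `[0,a]`. -/
theorem ambarzumyan_interval
    (a : ℝ) (ha : 0 < a) (q : ℝ → ℝ) (hq : ContinuousOn q (Set.Icc 0 a))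
    (hspec : {lam : ℝ | IsNeumannEigenvalue a q lam} =
             {lam : ℝ | IsNeumannEigenvalue a (fun _ => 0) lam}) :
    ∀ x ∈ Set.Icc (0 : ℝ) a, q x = 0 := by
  obtain ⟨Q, hQ⟩ := isCompact_Icc.exists_bound_of_continuousOn hq
  set p := IccExtend ha.le ((Icc 0 a).domRestrict q) with hp
  have hcp : Continuous p := (continuousOn_iff_continuous_domRestrict.1 hq).Icc_extend'
  have hpq : EqOn p q (Icc 0 a) := fun x hx ↦ by
    rw [hp, IccExtend_of_mem _ _ hx, domRestrict_apply]
  obtain ⟨lam, v, hv0, hva, hv⟩ := exists_riccati_solution ha hcp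
    fun x ↦ hQ _ (projIcc 0 a ha.le x).2
  replace hv : ∀ t ∈ Icc 0 a, HasDerivAt v (q t - lam - v t ^ 2) t := fun t ht ↦ by
    rw [← hpq ht]; exact hv t ht
  have hspec' : ∀ mu, IsNeumannEigenvalue a q mu ↔ IsNeumannEigenvalue a (fun _ ↦ 0) mu :=
    fun mu ↦ Set.ext_iff.1 hspec mu
  have hlam : 0 ≤ lam :=
    ((hspec' lam).1 (.of_riccati ha.le hq hv0 hva hv)).nonneg_of_zero_potential ha
  have hint := integral_eq_zero_of_isNeumannEigenvalue ha hq fun n ↦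
    (hspec' _).2 (isNeumannEigenvalue_zero_potential ha.le
      (by rw [div_mul_cancel₀ _ ha.ne']; exact Real.sin_nat_mul_pi n))
  exact eq_zero_of_riccati ha hlam hq hint hv0 hva hv
end

section
/- Let $I \geq 2$, let $a_1,\dots,a_I > 0$, and let $q_i : [0,a_i] \to \mathbb{R}$ be continuous for $i = 1,\dots,I$. For a family of continuous potentials $P = (p_1,\dots,p_I)$ with $p_i : [0,a_i] \to \mathbb{R}$, call $\lambda \in \mathbb{R}$ an eigenvalue of the Neumann star problem for $P$ if there exist twice continuously differentiable functions $y_i : [0,a_i] \to \mathbb{R}$, not all identically zero, satisfying $-y_i''(x) + p_i(x) y_i(x) = \lambda y_i(x)$ on $[0,a_i]$ for every $i$, the Neumann conditions $y_i'(0) = 0$ for every $i$, the continuity conditions $y_i(a_i) = y_j(a_j)$ for all $i, j$, and the Kirchhoff condition $\sum_{i=1}^I y_i'(a_i) = 0$. Let $\sigma(Q)$ denote the set of eigenvalues for $Q = (q_1,\dots,q_I)$ and $\sigma(\mathbf{0})$ the set of eigenvalues for the zero potentials. If $\sigma(Q) = \sigma(\mathbf{0})$, then $q_i(x) = 0$ for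 all $x \in [0,a_i]$ and all $i = 1,\dots,I$. -/
/-- `lam` is an eigenvalue of the Neumann star problem for the family of
potentials `p = (p₁, …, p_I)` on the star graph with edges `[0, a i]`:
there are twice continuously differentiable functions `y i` on `[0, a i]`,
not all identically zero, with `-yᵢ'' + pᵢ yᵢ = lam yᵢ`, Neumann conditions
`yᵢ'(0) = 0`, continuity `yᵢ(aᵢ) = yⱼ(aⱼ)` and the Kirchhoff condition
`∑ i, yᵢ'(aᵢ) = 0`. -/
def IsStarEigenvalue {I : ℕ} (a : Fin I → ℝ) (p : Fin I → ℝ → ℝ)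
    (lam : ℝ) : Prop :=
  ∃ y y' y'' : Fin I → ℝ → ℝ,
    (∀ i, ∀ x ∈ Set.Icc (0 : ℝ) (a i), HasDerivAt (y i) (y' i x) x) ∧
    (∀ i, ∀ x ∈ Set.Icc (0 : ℝ) (a i), HasDerivAt (y' i) (y'' i x) x) ∧
    (∀ i, ContinuousOn (y'' i) (Set.Icc 0 (a i))) ∧
    (∃ i, ∃ x ∈ Set.Icc (0 : ℝ) (a i), y i x ≠ 0) ∧
    (∀ i, ∀ x ∈ Set.Icc (0 : ℝ) (a i),
      -(y'' i x) + p i x * y i x = lam * y i x) ∧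
    (∀ i, y' i 0 = 0) ∧
    (∀ i j, y i (a i) = y j (a j)) ∧
    (∑ i, y' i (a i)) = 0

open Set Filter Topology MeasureTheory

section LinearODE

variable {P E : Type*} [NormedAddCommGroup E] [NormedSpace ℝ E]

/-- The Picard iterates of the linear equation `w' = A w` with initial value `w₀` at `0`, for a
coefficient `A` depending on a parameter. -/
noncomputable def linearPicardTerm (A : P → ℝ → E →L[ℝ] E) (w₀ : E) : ℕ → P → ℝ → E
  | 0, _, _ => w₀
  | n + 1, p, x => ∫ t in (0 : ℝ)..x, A p t (linearPicardTerm A w₀ n p t)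

variable {A : P → ℝ → E →L[ℝ] E} {w₀ : E} {K : P → ℝ}

lemma norm_linearPicardTerm_le (hK : ∀ p t, ‖A p t‖ ≤ K p) (n : ℕ) (p : P) (x : ℝ) :
    ‖linearPicardTerm A w₀ n p x‖ ≤ ‖w₀‖ * ((K p * |x|) ^ n / n.factorial) := by
  have hK0 : 0 ≤ K p := (norm_nonneg _).trans (hK p 0)
  induction n generalizing x with
  | zero => simp [linearPicardTerm]
  | succ n ih =>
    have hb : ∀ t, ‖A p t (linearPicardTerm A w₀ n p t)‖ ≤
        K p * (‖w₀‖ * ((K p * |t|) ^ n / n.factorial)) := fun t =>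
      ((A p t).le_opNorm _).trans (mul_le_mul (hK p t) (ih t) (norm_nonneg _) hK0)
    have hint : ∀ y : ℝ, 0 ≤ y →
        ∫ t in (0 : ℝ)..y, K p * (‖w₀‖ * ((K p * t) ^ n / n.factorial)) =
          ‖w₀‖ * ((K p * y) ^ (n + 1) / (n + 1).factorial) := by
      intro y hy
      have : ∀ t : ℝ, K p * (‖w₀‖ * ((K p * t) ^ n / n.factorial)) =
          (‖w₀‖ * K p ^ (n + 1) / n.factorial) * t ^ n := by
        intro t; rw [mul_pow]; ring
      simp_rw [this]
      rw [intervalIntegral.integral_const_mul, integral_pow, Nat.factorial_succ]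
      push_cast
      have : (n.factorial : ℝ) ≠ 0 := by positivity
      field_simp
      simp [mul_pow]
      ring
    rcases le_total 0 x with hx | hx
    · rw [abs_of_nonneg hx, ← hint x hx]
      refine intervalIntegral.norm_integral_le_of_norm_le hx (ae_of_all _ fun t ht => ?_)
        (Continuous.intervalIntegrable (by fun_prop) _ _)
      simpa [abs_of_pos ht.1] using hb t
    · rw [abs_of_nonpos hx, ← hint (-x) (by linarith)]
      have e : linearPicardTerm A w₀ (n + 1) p x =
          -∫ t in (0 : ℝ)..(-x), A p (-t) (linearPicardTerm A w₀ n p (-t)) := by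
        rw [intervalIntegral.integral_comp_neg
          (fun t => A p t (linearPicardTerm A w₀ n p t)), neg_neg, neg_zero,
          intervalIntegral.integral_symm, neg_neg]
        rfl
      rw [e, norm_neg]
      refine intervalIntegral.norm_integral_le_of_norm_le (by linarith)
        (ae_of_all _ fun t ht => ?_) (Continuous.intervalIntegrable (by fun_prop) _ _)
      simpa [abs_of_pos ht.1] using hb (-t)

variable [TopologicalSpace P]

lemma continuous_linearPicardTerm (hA : Continuous (Function.uncurry A)) (n : ℕ) :
    Continuous (Function.uncurry (linearPicardTerm A w₀ n)) := by
  induction n with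
  | zero => exact continuous_const
  | succ n ih =>
    have h : Continuous (Function.uncurry fun (z : P × ℝ) (t : ℝ) =>
        A z.1 t (linearPicardTerm A w₀ n z.1 t)) := by
      have h1 : Continuous fun z : (P × ℝ) × ℝ => (z.1.1, z.2) := by fun_prop
      exact (hA.comp h1).clm_apply (ih.comp h1)
    exact intervalIntegral.continuous_parametric_intervalIntegral_of_continuous h continuous_snd

/-- A linear differential equation whose coefficient depends continuously on a parameter, and is
bounded in time, has global solutions which are jointly continuous in the parameter and time. -/
theorem exists_linearODE_solution [CompleteSpace E] (hA : Continuous (Function.uncurry A))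
    (hKc : Continuous K) (hK : ∀ p t, ‖A p t‖ ≤ K p) (w₀ : E) :
    ∃ w : P → ℝ → E, Continuous (Function.uncurry w) ∧ (∀ p, w p 0 = w₀) ∧
      ∀ p x, HasDerivAt (w p) (A p x (w p x)) x := by
  have hbound : ∀ (R : ℝ) (n : ℕ) (p : P) (x : ℝ), K p * |x| ≤ R →
      ‖linearPicardTerm A w₀ n p x‖ ≤ ‖w₀‖ * (R ^ n / n.factorial) := by
    intro R n p x hR
    refine (norm_linearPicardTerm_le hK n p x).trans ?_
    have : 0 ≤ K p * |x| := mul_nonneg ((norm_nonneg _).trans (hK p 0)) (abs_nonneg _)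
    gcongr
  have hsum : ∀ R : ℝ, Summable fun n : ℕ => ‖w₀‖ * (R ^ n / n.factorial) := fun R =>
    (Real.summable_pow_div_factorial R).mul_left _
  have hs : ∀ p x, Summable fun n => linearPicardTerm A w₀ n p x := fun p x =>
    Summable.of_norm_bounded (hsum (K p * |x|)) fun n => hbound _ n p x le_rfl
  set w : P → ℝ → E := fun p x => ∑' n, linearPicardTerm A w₀ n p x with hw
  have hwc : Continuous (Function.uncurry w) := by
    rw [continuous_iff_continuousAt]
    rintro ⟨p, x⟩
    have hg : Continuous fun z : P × ℝ => K z.1 * |z.2| := by fun_prop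
    have hU : {z : P × ℝ | K z.1 * |z.2| < K p * |x| + 1} ∈ 𝓝 (p, x) :=
      (isOpen_lt hg continuous_const).mem_nhds (by simp)
    refine ContinuousOn.continuousAt ?_ hU
    exact continuousOn_tsum (fun n => (continuous_linearPicardTerm hA n).continuousOn)
      (hsum (K p * |x| + 1)) fun n z hz => hbound _ n z.1 z.2 (le_of_lt hz)
  have hint : ∀ p x, w p x = w₀ + ∫ t in (0 : ℝ)..x, A p t (w p t) := by
    intro p x
    have hK0 : 0 ≤ K p := (norm_nonneg _).trans (hK p 0)
    have h1 : HasSum (fun n => ∫ t in (0 : ℝ)..x, A p t (linearPicardTerm A w₀ n p t))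
        (∫ t in (0 : ℝ)..x, A p t (w p t)) := by
      refine intervalIntegral.hasSum_integral_of_dominated_convergence
        (fun n _ => K p * (‖w₀‖ * ((K p * |x|) ^ n / n.factorial))) ?_ ?_ ?_ ?_ ?_
      · intro n
        have h2 : Continuous fun t : ℝ => (p, t) := by fun_prop
        exact ((hA.comp h2).clm_apply
          ((continuous_linearPicardTerm (w₀ := w₀) hA n).comp h2)).aestronglyMeasurable
      · intro n
        refine ae_of_all _ fun t ht => ?_
        have htx : |t| ≤ |x| := by
          rcases le_total 0 x with hx | hx
          · rw [uIoc_of_le hx] at ht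
            rw [abs_of_pos ht.1, abs_of_nonneg hx]; exact ht.2
          · rw [uIoc_of_ge hx] at ht
            rw [abs_of_nonpos ht.2, abs_of_nonpos hx]; linarith [ht.1]
        exact ((A p t).le_opNorm _).trans (mul_le_mul (hK p t)
          (hbound _ n p t (by gcongr)) (norm_nonneg _) hK0)
      · exact ae_of_all _ fun t _ => (hsum _).mul_left _
      · exact intervalIntegrable_const
      · exact ae_of_all _ fun t _ => (A p t).hasSum (hs p t).hasSum
    rw [h1.tsum_eq.symm, hw]
    exact (hs p x).tsum_eq_zero_add
  refine ⟨w, hwc, fun p => by rw [hint]; simp, fun p x => ?_⟩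
  have h2 : Continuous fun t : ℝ => (p, t) := by fun_prop
  have hc : Continuous fun t => A p t (w p t) := (hA.comp h2).clm_apply (hwc.comp h2)
  have h3 := (intervalIntegral.integral_hasDerivAt_right (hc.intervalIntegrable 0 x)
    (hc.stronglyMeasurableAtFilter _ _) hc.continuousAt).const_add w₀
  exact h3.congr_of_eventuallyEq (Eventually.of_forall fun y => hint p y)

end LinearODE

section SchrodingerSolution

/-- `C lam` is the solution of `y'' = (q - lam) y` on the line with `y(0) = 1` and `y'(0) = 0`,
`D lam` is its derivative, and both depend jointly continuously on `lam` and on the point. -/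
structure IsNeumannSolution (q : ℝ → ℝ) (C D : ℝ → ℝ → ℝ) : Prop where
  continuous_fst : Continuous (Function.uncurry C)
  continuous_snd : Continuous (Function.uncurry D)
  apply_zero : ∀ lam, C lam 0 = 1
  deriv_zero : ∀ lam, D lam 0 = 0
  hasDerivAt_fst : ∀ lam x, HasDerivAt (C lam) (D lam x) x
  hasDerivAt_snd : ∀ lam x, HasDerivAt (D lam) ((q x - lam) * C lam x) x

theorem exists_isNeumannSolution {q : ℝ → ℝ} (hq : Continuous q) {M : ℝ}
    (hM : ∀ x, |q x| ≤ M) : ∃ C D, IsNeumannSolution q C D := by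
  let A : ℝ → ℝ → ℝ × ℝ →L[ℝ] ℝ × ℝ := fun lam t =>
    (ContinuousLinearMap.inl ℝ ℝ ℝ).comp (ContinuousLinearMap.snd ℝ ℝ ℝ) +
      (q t - lam) • (ContinuousLinearMap.inr ℝ ℝ ℝ).comp (ContinuousLinearMap.fst ℝ ℝ ℝ)
  have hAapp : ∀ lam t z, A lam t z = (z.2, (q t - lam) * z.1) := by
    intro lam t z; simp [A]
  have hAc : Continuous (Function.uncurry A) := by
    simp only [A, Function.uncurry_def]
    fun_prop
  have hK : ∀ lam t, ‖A lam t‖ ≤ 1 + M + |lam| := by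
    intro lam t
    have hM0 : 0 ≤ M := (abs_nonneg _).trans (hM 0)
    have h1 : |q t - lam| ≤ M + |lam| := (abs_sub _ _).trans (by linarith [hM t])
    refine ContinuousLinearMap.opNorm_le_bound _ (by positivity) fun z => ?_
    rw [hAapp, Prod.norm_def]
    refine max_le ?_ ?_
    · have := norm_snd_le z
      have h0 := norm_nonneg z
      have h2 : 0 ≤ (M + |lam|) * ‖z‖ := by positivity
      linarith
    · simp only [norm_mul, Real.norm_eq_abs]
      have h0 : |z.1| ≤ ‖z‖ := norm_fst_le z
      have h3 := mul_le_mul h1 h0 (abs_nonneg _) (by positivity)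
      linarith [norm_nonneg z]
  obtain ⟨w, hw, hw0, hwd⟩ := exists_linearODE_solution hAc
    (K := fun lam => 1 + M + |lam|) (by fun_prop) hK ((1, 0) : ℝ × ℝ)
  refine ⟨fun lam x => (w lam x).1, fun lam x => (w lam x).2, hw.fst, hw.snd, ?_, ?_, ?_, ?_⟩
  · intro lam; simp [hw0]
  · intro lam; simp [hw0]
  · intro lam x
    have := hwd lam x
    rw [hAapp] at this
    exact this.fst
  · intro lam x
    have := hwd lam x
    rw [hAapp] at this
    exact this.snd

/-- A nontrivial solution of a second order linear equation has no double zero. -/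
theorem eq_zero_of_double_zero {r : ℝ → ℝ} {M : ℝ} (hM : ∀ x, |r x| ≤ M) {C D : ℝ → ℝ}
    (hC : ∀ x, HasDerivAt C (D x) x) (hD : ∀ x, HasDerivAt D (r x * C x) x) {x₀ : ℝ}
    (hC0 : C x₀ = 0) (hD0 : D x₀ = 0) (x : ℝ) : C x = 0 := by
  have hM0 : 0 ≤ M := (abs_nonneg _).trans (hM 0)
  have h := ODE_solution_unique_univ (v := fun t (z : ℝ × ℝ) => (z.2, r t * z.1))
    (K := (1 + M).toNNReal) (s := fun _ => univ) (f := fun t => (C t, D t)) (g := fun _ => 0)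
    (t₀ := x₀) ?_ (fun t => ⟨(hC t).prodMk (hD t), mem_univ _⟩)
    (fun t => ⟨by simpa using! hasDerivAt_const t (0 : ℝ × ℝ), mem_univ _⟩) (by simp [hC0, hD0])
  · exact congrArg Prod.fst (congrFun h x)
  · intro t
    refine (LipschitzWith.of_dist_le_mul fun z w => ?_).lipschitzOnWith
    rw [Real.coe_toNNReal _ (by linarith), dist_eq_norm, dist_eq_norm, Prod.norm_def]
    have h0 := norm_nonneg (z - w)
    refine max_le ?_ ?_
    · have : ‖z.2 - w.2‖ ≤ ‖z - w‖ := norm_snd_le (z - w)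
      have h2 : 0 ≤ M * ‖z - w‖ := by positivity
      change ‖z.2 - w.2‖ ≤ _
      linarith
    · have h1 : ‖z.1 - w.1‖ ≤ ‖z - w‖ := norm_fst_le (z - w)
      have h3 := mul_le_mul (hM t) h1 (norm_nonneg _) hM0
      simp only [Prod.snd_sub, ← mul_sub, norm_mul]
      rw [Real.norm_eq_abs (r t)]
      linarith

/-- Below the minimum of the potential the Neumann solution grows. -/
theorem neumannSolution_pos_of_one_le {r C D : ℝ → ℝ} (hr : ∀ x, 1 ≤ r x)
    (hC0 : C 0 = 1) (hD0 : D 0 = 0) (hC : ∀ x, HasDerivAt C (D x) x)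
    (hD : ∀ x, HasDerivAt D (r x * C x) x) :
    (∀ x, 0 ≤ x → 0 < C x) ∧ ∀ x, 0 < x → 0 < D x := by
  have hCD : ∀ x, HasDerivAt (fun x => C x * D x) (D x ^ 2 + r x * C x ^ 2) x := fun x =>
    ((hC x).mul (hD x)).congr_deriv (by ring)
  have hmono : Monotone fun x => C x * D x :=
    monotone_of_hasDerivAt_nonneg hCD fun x => by
      have := mul_nonneg (zero_le_one.trans (hr x)) (sq_nonneg (C x))
      have := sq_nonneg (D x)
      simp only [Pi.zero_apply]
      linarith
  have hCD0 : ∀ x, 0 ≤ x → 0 ≤ C x * D x := fun x hx => by simpa [hD0] using hmono hx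
  have hsq : MonotoneOn (fun x => C x ^ 2) (Ici 0) := by
    refine monotoneOn_of_hasDerivWithinAt_nonneg (f' := fun x => 2 * (C x * D x)) (convex_Ici 0)
      ?_ ?_ ?_
    · exact fun x _ => ((hC x).continuousAt.pow 2).continuousWithinAt
    · intro x _
      exact (((hC x).pow 2).congr_deriv (by norm_num; ring)).hasDerivWithinAt
    · intro x hx
      rw [interior_Ici] at hx
      linarith [hCD0 x (le_of_lt hx)]
  have hge : ∀ x, 0 ≤ x → 1 ≤ C x ^ 2 := fun x hx => by
    simpa [hC0] using hsq (mem_Ici.2 le_rfl) (mem_Ici.2 hx) hx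
  have hcont : Continuous C := continuous_iff_continuousAt.2 fun x => (hC x).continuousAt
  have hpos : ∀ x, 0 ≤ x → 0 < C x := by
    intro x hx
    by_contra hneg
    obtain ⟨z, hz, hz0⟩ := intermediate_value_Icc' hx hcont.continuousOn
      (show (0 : ℝ) ∈ Icc (C x) (C 0) from ⟨not_lt.1 hneg, by simp [hC0]⟩)
    have := hge z hz.1
    rw [hz0] at this
    norm_num at this
  refine ⟨hpos, fun x hx => ?_⟩
  have hDm : StrictMonoOn D (Ici 0) := by
    refine strictMonoOn_of_hasDerivWithinAt_pos (f' := fun x => r x * C x) (convex_Ici 0)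
      ?_ ?_ ?_
    · exact fun x _ => (hD x).continuousAt.continuousWithinAt
    · exact fun x _ => (hD x).hasDerivWithinAt
    · intro x hx
      rw [interior_Ici] at hx
      exact mul_pos (zero_lt_one.trans_le (hr x)) (hpos x (le_of_lt hx))
  simpa [hD0] using hDm (mem_Ici.2 le_rfl) (mem_Ici.2 hx.le) hx

end SchrodingerSolution

section FreeStar

open Real

/-- The free Neumann star has arbitrarily large eigenfrequencies at which all the edges are nearly
integer multiples of the half wave length. -/
theorem exists_resonant_frequency {I : ℕ} (hI : 0 < I) {a : Fin I → ℝ} (ha : ∀ i, 0 < a i)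
    {η : ℝ} (hη : 0 < η) (hη1 : η ≤ 1) (T : ℝ) :
    ∃ k, T ≤ k ∧ ∑ i, tan (k * a i) = 0 ∧ ∀ i, 1 - η ^ 2 ≤ cos (k * a i) ^ 2 := by
  have : Nonempty (Fin I) := ⟨⟨0, hI⟩⟩
  have : Fact (0 < π) := ⟨pi_pos⟩
  have hL : 0 < ∑ i, a i := Finset.sum_pos (fun i _ => ha i) Finset.univ_nonempty
  set δ := η / (2 * ∑ i, a i) with hδ
  have hδ0 : 0 < δ := by positivity
  have hδa : ∀ i, 2 * (δ * a i) ≤ η := by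
    intro i
    have h1 : a i ≤ ∑ i, a i :=
      Finset.single_le_sum (f := a) (fun j _ => (ha j).le) (Finset.mem_univ i)
    calc 2 * (δ * a i) ≤ 2 * (δ * ∑ i, a i) := by gcongr
      _ = η := by rw [hδ]; field_simp
  obtain ⟨N, hNT, hN⟩ : ∃ N : ℕ, T + δ ≤ N ∧ ∀ i, ∃ m : ℤ, |N * a i - m * π| < δ * a i := by
    have hcl := mapClusterPt_zero_atTop_nsmul (fun i => (a i : AddCircle π))
    have hnhds : {x : Fin I → AddCircle π | ∀ i, ‖x i‖ < δ * a i} ∈ 𝓝 0 := by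
      refine IsOpen.mem_nhds ?_ fun i => by simpa using mul_pos hδ0 (ha i)
      simp only [ofPred_forall]
      exact isOpen_iInter_of_finite fun i =>
        isOpen_lt (continuous_norm.comp (continuous_apply i)) continuous_const
    obtain ⟨N, hN, hNT⟩ := ((hcl.frequently hnhds).and_eventually
      (tendsto_natCast_atTop_atTop.eventually_ge_atTop (T + δ))).exists
    refine ⟨N, hNT, fun i => ⟨round (π⁻¹ * (N * a i)), ?_⟩⟩
    have := hN i
    rw [← AddCircle.norm_eq]
    convert this using 2
    simp
  choose m hm using hN
  have hclose : ∀ k ∈ Icc (N - δ) (N + δ), ∀ i, |k * a i - m i * π| ≤ η := by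
    intro k hk i
    have h1 : |(k - N) * a i| ≤ δ * a i := by
      rw [abs_mul, abs_of_pos (ha i)]
      exact mul_le_mul_of_nonneg_right (abs_le.2 ⟨by linarith [hk.1], by linarith [hk.2]⟩) (ha i).le
    calc |k * a i - m i * π| = |(k - N) * a i + (N * a i - m i * π)| := by ring_nf
      _ ≤ |(k - N) * a i| + |N * a i - m i * π| := abs_add_le _ _
      _ ≤ η := by linarith [hm i, hδa i]
  have hηpi : η < π / 2 := by linarith [pi_gt_three]
  have htan : ∀ k i, tan (k * a i) = tan (k * a i - m i * π) := fun k i =>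
    (tan_sub_int_mul_pi _ _).symm
  have hcont : ContinuousOn (fun k => ∑ i, tan (k * a i)) (Icc (N - δ) (N + δ)) := by
    simp_rw [htan]
    refine continuousOn_finsetSum _ fun i _ => ?_
    refine continuousOn_tan_Ioo.comp (by fun_prop) fun k hk => ?_
    have := abs_le.1 (hclose k hk i)
    exact ⟨by linarith, by linarith⟩
  have hright : 0 ≤ ∑ i, tan ((N + δ) * a i) := by
    simp_rw [htan]
    refine Finset.sum_nonneg fun i _ => tan_nonneg_of_nonneg_of_le_pi_div_two ?_ ?_
    · linarith [abs_lt.1 (hm i)]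
    · linarith [abs_le.1 (hclose (N + δ) ⟨by linarith, le_rfl⟩ i)]
  have hleft : ∑ i, tan ((N - δ) * a i) ≤ 0 := by
    simp_rw [htan]
    refine Finset.sum_nonpos fun i _ => tan_nonpos_of_nonpos_of_neg_pi_div_two_le ?_ ?_
    · linarith [abs_lt.1 (hm i)]
    · linarith [abs_le.1 (hclose (N - δ) ⟨le_rfl, by linarith⟩ i)]
  obtain ⟨k, hk, hk0⟩ := intermediate_value_Icc (by linarith) hcont
    (show (0 : ℝ) ∈ Icc _ _ from ⟨hleft, hright⟩)
  refine ⟨k, by linarith [hk.1], hk0, fun i => ?_⟩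
  have h1 : sin (k * a i) ^ 2 = sin (k * a i - m i * π) ^ 2 := by
    rw [sin_sub_int_mul_pi, mul_pow, ← zpow_natCast ((-1 : ℝ) ^ m i), zpow_comm]
    simp
  have h2 : sin (k * a i - m i * π) ^ 2 ≤ η ^ 2 :=
    sq_le_sq.2 ((abs_sin_le_abs.trans (hclose k hk i)).trans (le_abs_self η))
  linarith [sin_sq_add_cos_sq (k * a i)]

/-- The square of a frequency `k` with `∑ tan (k aᵢ) = 0` is an eigenvalue of the free star. -/
theorem isStarEigenvalue_zero_of_sum_tan {I : ℕ} (hI : 0 < I) {a : Fin I → ℝ}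
    (ha : ∀ i, 0 < a i) {k : ℝ} (htan : ∑ i, tan (k * a i) = 0)
    (hcos : ∀ i, cos (k * a i) ≠ 0) : IsStarEigenvalue a (fun _ _ => 0) (k ^ 2) := by
  refine ⟨fun i x => cos (k * x) / cos (k * a i), fun i x => -(k * sin (k * x)) / cos (k * a i),
    fun i x => -(k ^ 2 * cos (k * x)) / cos (k * a i), ?_, ?_, ?_, ?_, ?_, ?_, ?_, ?_⟩
  · intro i x _
    exact (((hasDerivAt_id x).const_mul k).cos.div_const (cos (k * a i))).congr_deriv
      (by simp only [id_eq]; ring)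
  · intro i x _
    exact ((((hasDerivAt_id x).const_mul k).sin.const_mul k).neg.div_const
      (cos (k * a i))).congr_deriv (by simp only [id_eq]; ring)
  · intro i
    fun_prop
  · exact ⟨⟨0, hI⟩, 0, ⟨le_rfl, (ha _).le⟩, by simpa using hcos _⟩
  · intro i x _
    ring
  · intro i
    simp
  · intro i j
    simp [hcos]
  · have : ∀ i, -(k * sin (k * a i)) / cos (k * a i) = -k * tan (k * a i) := fun i => by
      rw [tan_eq_sin_div_cos]; ring
    simp_rw [this, ← Finset.mul_sum, htan, mul_zero]

/-- The free star has the eigenvalue `0`. -/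
theorem isStarEigenvalue_zero_zero {I : ℕ} (hI : 0 < I) {a : Fin I → ℝ} (ha : ∀ i, 0 < a i) :
    IsStarEigenvalue a (fun _ _ => 0) 0 := by
  simpa using isStarEigenvalue_zero_of_sum_tan hI ha (k := 0) (by simp) (by simp)

/-- The free star has no negative eigenvalue. -/
theorem not_isStarEigenvalue_zero_of_neg {I : ℕ} {a : Fin I → ℝ} (ha : ∀ i, 0 < a i) {lam : ℝ}
    (hlam : lam < 0) : ¬ IsStarEigenvalue a (fun _ _ => 0) lam := by
  rintro ⟨y, y', y'', hy, hy', -, ⟨i₀, x₀, hx₀, hne⟩, hode, h0, hcont, hsum⟩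
  have hd : ∀ i, ∀ x ∈ Icc 0 (a i),
      HasDerivAt (fun x => y i x * y' i x) (y' i x ^ 2 + -lam * y i x ^ 2) x := by
    intro i x hx
    have : y'' i x = -lam * y i x := by linarith [hode i x hx]
    exact ((hy i x hx).mul (hy' i x hx)).congr_deriv (by rw [this]; ring)
  have hmono : ∀ i, MonotoneOn (fun x => y i x * y' i x) (Icc 0 (a i)) := fun i =>
    monotoneOn_of_hasDerivWithinAt_nonneg (convex_Icc _ _)
      (fun x hx => (hd i x hx).continuousAt.continuousWithinAt)
      (fun x hx => (hd i x (interior_subset hx)).hasDerivWithinAt) fun x _ => by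
        have := mul_nonneg (neg_nonneg.2 hlam.le) (sq_nonneg (y i x))
        positivity
  have hend : ∀ i, 0 ≤ y i (a i) * y' i (a i) := fun i => by
    simpa [h0] using hmono i ⟨le_rfl, (ha i).le⟩ ⟨(ha i).le, le_rfl⟩ (ha i).le
  have hends : ∑ i, y i (a i) * y' i (a i) = 0 := by
    simp_rw [fun i => hcont i i₀, ← Finset.mul_sum, hsum, mul_zero]
  have hzero : y i₀ (a i₀) * y' i₀ (a i₀) = 0 :=
    (Finset.sum_eq_zero_iff_of_nonneg fun i _ => hend i).1 hends i₀ (Finset.mem_univ _)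
  have hconst : ∀ x ∈ Icc 0 (a i₀), y i₀ x * y' i₀ x = 0 := by
    intro x hx
    have h1 := hmono i₀ ⟨le_rfl, (ha i₀).le⟩ hx hx.1
    have h2 := hmono i₀ hx ⟨(ha i₀).le, le_rfl⟩ hx.2
    simp only [h0, mul_zero, hzero] at h1 h2
    exact le_antisymm h2 h1
  have h3 : HasDerivWithinAt (fun x => y i₀ x * y' i₀ x) 0 (Icc 0 (a i₀)) x₀ :=
    (hasDerivWithinAt_const x₀ _ (0 : ℝ)).congr hconst (hconst x₀ hx₀)
  have h4 := (uniqueDiffOn_Icc (ha i₀) x₀ hx₀).eq_deriv _ (hd i₀ x₀ hx₀).hasDerivWithinAt h3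
  have h5 : 0 < -lam * y i₀ x₀ ^ 2 := mul_pos (neg_pos.2 hlam) (by positivity)
  linarith [sq_nonneg (y' i₀ x₀)]

end FreeStar

section Asymptotics

open Real

/-- The Riemann-Lebesgue lemma for cosine integrals over an interval. -/
theorem tendsto_integral_mul_cos {g : ℝ → ℝ} (hg : Continuous g) {a : ℝ} (ha : 0 ≤ a) :
    Tendsto (fun k => ∫ x in (0 : ℝ)..a, g x * cos (k * x)) atTop (𝓝 0) := by
  have h := Real.tendsto_integral_exp_smul_cocompact
    ((Ioc 0 a).indicator fun x => (g x : ℂ))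
  have hk : Tendsto (fun k : ℝ => k / (2 * π)) atTop (cocompact ℝ) :=
    (tendsto_id.atTop_div_const (by positivity)).mono_right atTop_le_cocompact
  have h2 := (Complex.continuous_re.tendsto 0).comp (h.comp hk)
  simp only [Complex.zero_re] at h2
  refine h2.congr fun k => ?_
  have h3 : ∀ v : ℝ, Real.fourierChar (-(v * (k / (2 * π)))) •
      (Ioc 0 a).indicator (fun x => (g x : ℂ)) v =
      (Ioc 0 a).indicator (fun x => Complex.exp (↑(-(k * x)) * Complex.I) * (g x : ℂ)) v := by
    intro v
    by_cases hv : v ∈ Ioc 0 a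
    · rw [indicator_of_mem hv, indicator_of_mem hv, Circle.smul_def, Real.fourierChar_apply,
        smul_eq_mul]
      congr 4
      field_simp
    · simp [indicator_of_notMem hv]
  have hint : IntervalIntegrable
      (fun x : ℝ => Complex.exp (↑(-(k * x)) * Complex.I) * (g x : ℂ)) volume 0 a :=
    Continuous.intervalIntegrable (by fun_prop) _ _
  simp only [Function.comp_apply, h3]
  rw [integral_indicator measurableSet_Ioc, ← intervalIntegral.integral_of_le ha]
  rw [← Complex.reCLM_apply, ← Complex.reCLM.intervalIntegral_comp_comm hint]
  refine intervalIntegral.integral_congr fun x _ => ?_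
  simp only [Complex.reCLM_apply, Complex.mul_re, Complex.exp_ofReal_mul_I_re, Complex.ofReal_re,
    Complex.ofReal_im, mul_zero, sub_zero, cos_neg]
  ring

theorem tendsto_integral_mul_cos_sq {g : ℝ → ℝ} (hg : Continuous g) {a : ℝ} (ha : 0 ≤ a) :
    Tendsto (fun k => ∫ x in (0 : ℝ)..a, g x * cos (k * x) ^ 2) atTop
      (𝓝 (1 / 2 * ∫ x in (0 : ℝ)..a, g x)) := by
  have h := ((tendsto_integral_mul_cos hg ha).comp
    (tendsto_id.const_mul_atTop (zero_lt_two' ℝ))).const_mul (1 / 2)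
  have h2 := h.const_add (1 / 2 * ∫ x in (0 : ℝ)..a, g x)
  rw [mul_zero, add_zero] at h2
  refine h2.congr fun k => ?_
  simp only [Function.comp_apply, id_eq]
  rw [← mul_add, ← intervalIntegral.integral_add (hg.intervalIntegrable _ _)
    (Continuous.intervalIntegrable (by fun_prop) _ _), ← intervalIntegral.integral_const_mul]
  refine intervalIntegral.integral_congr fun x _ => ?_
  simp only [cos_sq, mul_assoc]
  ring

variable {q y y' y'' : ℝ → ℝ} {a k M : ℝ}

/-- Variation of constants for `y'' = (q - k²) y` with a Neumann condition at `0`. -/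
theorem mul_sub_cos_eq_integral (hq : Continuous q)
    (hy : ∀ x ∈ Icc 0 a, HasDerivAt y (y' x) x) (hy' : ∀ x ∈ Icc 0 a, HasDerivAt y' (y'' x) x)
    (hode : ∀ x ∈ Icc 0 a, y'' x = (q x - k ^ 2) * y x) (h0 : y' 0 = 0) {x : ℝ}
    (hx : x ∈ Icc 0 a) :
    k * (y x - y 0 * cos (k * x)) = ∫ t in (0 : ℝ)..x, sin (k * (x - t)) * (q t * y t) := by
  have hsub : ∀ t ∈ uIcc 0 x, t ∈ Icc 0 a := fun t ht => by
    rw [uIcc_of_le hx.1] at ht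
    exact ⟨ht.1, ht.2.trans hx.2⟩
  have hc : ContinuousOn y (uIcc 0 x) := fun t ht =>
    (hy t (hsub t ht)).continuousAt.continuousWithinAt
  rw [intervalIntegral.integral_eq_sub_of_hasDerivAt
    (f := fun t => sin (k * (x - t)) * y' t + k * (cos (k * (x - t)) * y t))]
  · simp [h0]; ring
  · intro t ht
    have h1 : HasDerivAt (fun t => k * (x - t)) (-k) t :=
      (((hasDerivAt_id t).const_sub x).const_mul k).congr_deriv (by ring)
    refine ((h1.sin.mul (hy' t (hsub t ht))).add
      ((h1.cos.mul (hy t (hsub t ht))).const_mul k)).congr_deriv ?_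
    rw [hode t (hsub t ht)]
    ring
  · exact ContinuousOn.intervalIntegrable (by fun_prop)

/-- For high frequencies the solution of `y'' = (q - k²) y` with a Neumann condition at `0` is
close to the free one. -/
theorem abs_sub_cos_le (hq : Continuous q) (hM : ∀ x, |q x| ≤ M) (hk : 0 < k)
    (hkM : 2 * M * a ≤ k) (hy : ∀ x ∈ Icc 0 a, HasDerivAt y (y' x) x)
    (hy' : ∀ x ∈ Icc 0 a, HasDerivAt y' (y'' x) x)
    (hode : ∀ x ∈ Icc 0 a, y'' x = (q x - k ^ 2) * y x) (h0 : y' 0 = 0) {x : ℝ}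
    (hx : x ∈ Icc 0 a) : |y x - y 0 * cos (k * x)| ≤ 2 * M * a * |y 0| / k := by
  have hM0 : 0 ≤ M := (abs_nonneg _).trans (hM 0)
  have hc : ContinuousOn y (Icc 0 a) := fun t ht => (hy t ht).continuousAt.continuousWithinAt
  obtain ⟨z, hz, hzmax⟩ := isCompact_Icc.exists_isMaxOn ⟨x, hx⟩ hc.abs
  have hbd : ∀ x ∈ Icc 0 a, k * |y x - y 0 * cos (k * x)| ≤ M * |y z| * a := by
    intro x hx
    rw [← abs_of_pos hk, ← abs_mul, abs_of_pos hk, mul_sub_cos_eq_integral hq hy hy' hode h0 hx]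
    have h1 := intervalIntegral.norm_integral_le_of_norm_le_const (a := 0) (b := x)
      (f := fun t => sin (k * (x - t)) * (q t * y t)) (C := M * |y z|) fun t ht => by
        rw [uIoc_of_le hx.1] at ht
        have h2 : |y t| ≤ |y z| := hzmax ⟨ht.1.le, ht.2.trans hx.2⟩
        rw [Real.norm_eq_abs, abs_mul, abs_mul]
        calc _ ≤ 1 * (M * |y z|) := by
              gcongr
              exacts [abs_sin_le_one _, hM t]
          _ = _ := one_mul _
    rw [Real.norm_eq_abs, sub_zero, abs_of_nonneg hx.1] at h1
    exact h1.trans (mul_le_mul_of_nonneg_left hx.2 (by positivity))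
  have hyz : |y z| ≤ 2 * |y 0| := by
    have h1 := hbd z hz
    have h2 : |y z| ≤ |y z - y 0 * cos (k * z)| + |y 0| := by
      have h3 : |y 0 * cos (k * z)| ≤ |y 0| := by
        rw [abs_mul]
        exact mul_le_of_le_one_right (abs_nonneg _) (abs_cos_le_one _)
      have := abs_add_le (y z - y 0 * cos (k * z)) (y 0 * cos (k * z))
      rw [sub_add_cancel] at this
      linarith
    have h4 : k * |y z| ≤ k * (2 * |y 0|) := by
      have h5 := mul_le_mul_of_nonneg_left h2 hk.le
      have h6 := mul_le_mul_of_nonneg_right hkM (abs_nonneg (y z))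
      linarith
    exact le_of_mul_le_mul_left h4 hk
  rw [le_div_iff₀ hk, mul_comm]
  refine (hbd x hx).trans ?_
  have := mul_le_mul_of_nonneg_left hyz (mul_nonneg hM0 (hx.1.trans hx.2))
  linarith

theorem deriv_add_mul_tan_eq (hq : Continuous q) (ha : 0 ≤ a)
    (hy : ∀ x ∈ Icc 0 a, HasDerivAt y (y' x) x) (hy' : ∀ x ∈ Icc 0 a, HasDerivAt y' (y'' x) x)
    (hode : ∀ x ∈ Icc 0 a, y'' x = (q x - k ^ 2) * y x) (h0 : y' 0 = 0) (h1 : y a = 1)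
    (hcos : cos (k * a) ≠ 0) :
    y' a + k * tan (k * a) = (∫ x in (0 : ℝ)..a, q x * y x * cos (k * x)) / cos (k * a) := by
  have hc : ContinuousOn y (uIcc 0 a) := fun t ht =>
    (hy t (by rwa [uIcc_of_le ha] at ht)).continuousAt.continuousWithinAt
  rw [intervalIntegral.integral_eq_sub_of_hasDerivAt
    (f := fun t => y' t * cos (k * t) + k * (y t * sin (k * t)))]
  · simp only [h0, h1, tan_eq_sin_div_cos, mul_zero, sin_zero]
    field_simp
    ring
  · intro t ht
    rw [uIcc_of_le ha] at ht
    have h2 : HasDerivAt (fun t => k * t) k t := by simpa using (hasDerivAt_id t).const_mul k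
    refine (((hy' t ht).mul h2.cos).add (((hy t ht).mul h2.sin).const_mul k)).congr_deriv ?_
    rw [hode t ht]
    ring
  · exact ContinuousOn.intervalIntegrable (by fun_prop)

/-- Along frequencies at which the edge is nearly a multiple of the half wave length, the
Dirichlet-to-Neumann data of an edge differ from the free ones by half the mean of the potential. -/
theorem tendsto_deriv_add_mul_tan (hq : Continuous q) (hM : ∀ x, |q x| ≤ M) (ha : 0 ≤ a)
    {k : ℕ → ℝ} (hk : Tendsto k atTop atTop)
    (hcos : Tendsto (fun n => cos (k n * a) ^ 2) atTop (𝓝 1)) {y y' y'' : ℕ → ℝ → ℝ}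
    (hy : ∀ n, ∀ x ∈ Icc 0 a, HasDerivAt (y n) (y' n x) x)
    (hy' : ∀ n, ∀ x ∈ Icc 0 a, HasDerivAt (y' n) (y'' n x) x)
    (hode : ∀ n, ∀ x ∈ Icc 0 a, y'' n x = (q x - k n ^ 2) * y n x) (h0 : ∀ n, y' n 0 = 0)
    (h1 : ∀ n, y n a = 1) :
    Tendsto (fun n => y' n a + k n * tan (k n * a)) atTop
      (𝓝 (1 / 2 * ∫ x in (0 : ℝ)..a, q x)) := by
  have hM0 : 0 ≤ M := (abs_nonneg _).trans (hM 0)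
  set B := 2 * M * a with hB
  have hB0 : 0 ≤ B := by positivity
  have hE : ∀ᶠ n in atTop, 0 < k n ∧ 4 * B ≤ k n ∧ 1 / 4 < cos (k n * a) ^ 2 :=
    (hk.eventually_gt_atTop 0).and ((hk.eventually_ge_atTop (4 * B)).and
      (hcos.eventually_const_lt (by norm_num)))
  have hclose : ∀ᶠ n in atTop, ∀ x ∈ Icc 0 a,
      |y n x - y n 0 * cos (k n * x)| ≤ B * |y n 0| / k n := by
    filter_upwards [hE] with n hn x hx
    exact abs_sub_cos_le hq hM hn.1 (by linarith [hn.2.1]) (hy n) (hy' n) (hode n) (h0 n) hx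
  have hcosabs : ∀ᶠ n in atTop, 1 / 2 ≤ |cos (k n * a)| := by
    filter_upwards [hE] with n hn
    rw [← abs_of_pos (one_half_pos (α := ℝ))]
    exact sq_le_sq.1 (by linarith [hn.2.2])
  have hinit : ∀ᶠ n in atTop, |y n 0| ≤ 4 := by
    filter_upwards [hE, hclose, hcosabs] with n hn hc he
    have h2 := hc a ⟨ha, le_rfl⟩
    rw [h1] at h2
    have h3 : B * |y n 0| / k n ≤ |y n 0| / 4 := by
      rw [div_le_div_iff₀ hn.1 (by norm_num)]
      linarith [mul_le_mul_of_nonneg_right hn.2.1 (abs_nonneg (y n 0))]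
    have h4 : |y n 0| * (1 / 2) ≤ |y n 0 * cos (k n * a)| := by
      rw [abs_mul]; gcongr
    have h5 := abs_sub_abs_le_abs_sub (y n 0 * cos (k n * a)) 1
    rw [abs_sub_comm, abs_one] at h5
    linarith
  have hdecay : ∀ R : ℝ, Tendsto (fun n => R / k n) atTop (𝓝 0) := fun R =>
    tendsto_const_nhds.div_atTop hk
  have hprod : Tendsto (fun n => y n 0 * cos (k n * a)) atTop (𝓝 1) := by
    rw [tendsto_iff_norm_sub_tendsto_zero]
    refine squeeze_zero' (Eventually.of_forall fun n => norm_nonneg _) ?_ (hdecay (B * 4))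
    filter_upwards [hE, hclose, hinit] with n hn hc hi
    have h2 := hc a ⟨ha, le_rfl⟩
    rw [h1, abs_sub_comm] at h2
    rw [Real.norm_eq_abs]
    refine h2.trans ?_
    have := hn.1
    gcongr
  have hratio : Tendsto (fun n => y n 0 / cos (k n * a)) atTop (𝓝 1) := by
    have := hprod.div hcos one_ne_zero
    rw [div_one] at this
    refine this.congr' ?_
    filter_upwards [hcosabs] with n he
    have : cos (k n * a) ≠ 0 := by
      intro h; rw [h] at he; norm_num at he
    simp only [Pi.div_apply]
    field_simp
  have hmain : Tendsto (fun n => y n 0 / cos (k n * a) *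
      ∫ x in (0 : ℝ)..a, q x * cos (k n * x) ^ 2) atTop (𝓝 (1 / 2 * ∫ x in (0 : ℝ)..a, q x)) := by
    simpa using hratio.mul ((tendsto_integral_mul_cos_sq hq ha).comp hk)
  refine tendsto_of_tendsto_of_dist hmain ?_
  refine squeeze_zero' (Eventually.of_forall fun n => dist_nonneg) ?_ (hdecay (8 * B * M * a))
  filter_upwards [hE, hclose, hinit, hcosabs] with n hn hc hi he
  have hcne : cos (k n * a) ≠ 0 := by
    intro h; rw [h] at he; norm_num at he
  have hyc : ContinuousOn (y n) (uIcc 0 a) := fun t ht =>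
    (hy n t (by rwa [uIcc_of_le ha] at ht)).continuousAt.continuousWithinAt
  have hkn := hn.1
  rw [deriv_add_mul_tan_eq hq ha (hy n) (hy' n) (hode n) (h0 n) (h1 n) hcne, dist_comm,
    Real.dist_eq, div_mul_eq_mul_div, ← sub_div, abs_div, ← intervalIntegral.integral_const_mul,
    ← intervalIntegral.integral_sub (ContinuousOn.intervalIntegrable (by fun_prop))
      (ContinuousOn.intervalIntegrable (by fun_prop)), div_le_iff₀ (by linarith)]
  have h2 := intervalIntegral.norm_integral_le_of_norm_le_const (a := 0) (b := a)
    (f := fun x => q x * y n x * cos (k n * x) - y n 0 * (q x * cos (k n * x) ^ 2))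
    (C := M * (B * 4 / k n)) fun x hx => by
      rw [uIoc_of_le ha] at hx
      have h3 : q x * y n x * cos (k n * x) - y n 0 * (q x * cos (k n * x) ^ 2) =
        q x * (y n x - y n 0 * cos (k n * x)) * cos (k n * x) := by ring
      have h4 : |y n x - y n 0 * cos (k n * x)| ≤ B * 4 / k n := by
        refine (hc x ⟨hx.1.le, hx.2⟩).trans ?_
        gcongr
      rw [h3, Real.norm_eq_abs, abs_mul, abs_mul]
      calc _ ≤ M * (B * 4 / k n) * 1 := by
            gcongr
            exacts [hM x, abs_cos_le_one _]
        _ = _ := mul_one _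
  rw [Real.norm_eq_abs, sub_zero, abs_of_nonneg ha] at h2
  refine h2.trans ?_
  calc M * (B * 4 / k n) * a = 8 * B * M * a / k n * (1 / 2) := by ring
    _ ≤ _ := by gcongr

end Asymptotics

section GroundState

/-- A function which is nonnegative on an interval and vanishes at its right end has a nonpositive
derivative there. -/
lemma HasDerivAt.nonpos_of_nonneg_left {f : ℝ → ℝ} {d a : ℝ} (ha : 0 < a) (hf : HasDerivAt f d a)
    (hnonneg : ∀ x ∈ Icc 0 a, 0 ≤ f x) (hfa : f a = 0) : d ≤ 0 := by
  have h : Tendsto (slope f a) (𝓝[<] a) (𝓝 d) :=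
    (hasDerivAt_iff_tendsto_slope.1 hf).mono_left
      (nhdsWithin_mono _ fun x hx => ne_of_lt hx)
  refine le_of_tendsto h ?_
  filter_upwards [Ioo_mem_nhdsLT ha] with x hx
  rw [slope_def_field, hfa, sub_zero]
  exact div_nonpos_of_nonneg_of_nonpos (hnonneg x ⟨hx.1.le, hx.2.le⟩) (by linarith [hx.2])

/-- A sum of functions, each tending to `-∞` or bounded above, and one of which tends to `-∞`,
tends to `-∞`. -/
lemma tendsto_finset_sum_atBot {ι α : Type*} [Fintype ι] {l : Filter α} {f : ι → α → ℝ} {i : ι}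
    (hi : Tendsto (f i) l atBot) (hb : ∀ j, ∃ B, ∀ᶠ x in l, f j x ≤ B) :
    Tendsto (fun x => ∑ j, f j x) l atBot := by
  classical
  choose B hB using hb
  refine tendsto_atBot_mono' l ?_
    (tendsto_atBot_add_const_right l (∑ j ∈ Finset.univ.erase i, B j) hi)
  filter_upwards [eventually_all.2 hB] with x hx
  rw [← Finset.add_sum_erase _ _ (Finset.mem_univ i)]
  exact add_le_add le_rfl (Finset.sum_le_sum fun j _ => hx j)

variable {I : ℕ} {a : Fin I → ℝ} {q : Fin I → ℝ → ℝ} {C D : Fin I → ℝ → ℝ → ℝ} {M : ℝ}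

theorem isStarEigenvalue_of_sum_div_eq_zero (hI : 0 < I) (ha : ∀ i, 0 < a i)
    (hq : ∀ i, Continuous (q i)) (hCD : ∀ i, IsNeumannSolution (q i) (C i) (D i)) {lam : ℝ}
    (hne : ∀ i, C i lam (a i) ≠ 0) (hsum : ∑ i, D i lam (a i) / C i lam (a i) = 0) :
    IsStarEigenvalue a q lam := by
  refine ⟨fun i x => C i lam x / C i lam (a i), fun i x => D i lam x / C i lam (a i),
    fun i x => (q i x - lam) * C i lam x / C i lam (a i), ?_, ?_, ?_, ?_, ?_, ?_, ?_, hsum⟩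
  · exact fun i x _ => ((hCD i).hasDerivAt_fst lam x).div_const _
  · exact fun i x _ => ((hCD i).hasDerivAt_snd lam x).div_const _
  · intro i
    have h1 : Continuous (C i lam) :=
      (hCD i).continuous_fst.comp (Continuous.prodMk_right lam)
    have h2 := hq i
    fun_prop
  · exact ⟨⟨0, hI⟩, 0, ⟨le_rfl, (ha _).le⟩, by simp [(hCD _).apply_zero, hne]⟩
  · intro i x _
    ring
  · intro i
    simp [(hCD i).deriv_zero]
  · intro i j
    simp [hne]

theorem IsNeumannSolution.deriv_neg_of_eq_zero {q : ℝ → ℝ} {C D : ℝ → ℝ → ℝ}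
    (hCD : IsNeumannSolution q C D) (hM : ∀ x, |q x| ≤ M) {a lam : ℝ} (ha : 0 < a)
    (hnonneg : ∀ x ∈ Icc 0 a, 0 ≤ C lam x) (hzero : C lam a = 0) : D lam a < 0 := by
  refine lt_of_le_of_ne
    ((hCD.hasDerivAt_fst lam a).nonpos_of_nonneg_left ha hnonneg hzero) fun h => ?_
  have := eq_zero_of_double_zero (r := fun x => q x - lam) (M := M + |lam|)
    (fun x => (abs_sub _ _).trans (by linarith [hM x])) (hCD.hasDerivAt_fst lam)
    (hCD.hasDerivAt_snd lam) hzero h 0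
  rw [hCD.apply_zero] at this
  exact one_ne_zero this

/-- A nonnegative Neumann solution can only vanish at the outer end of the edge. -/
theorem IsNeumannSolution.pos_of_nonneg {q : ℝ → ℝ} {C D : ℝ → ℝ → ℝ}
    (hCD : IsNeumannSolution q C D) (hM : ∀ x, |q x| ≤ M) {a lam : ℝ}
    (hnonneg : ∀ x ∈ Icc 0 a, 0 ≤ C lam x) {x : ℝ} (hx : x ∈ Ico 0 a) : 0 < C lam x := by
  refine lt_of_le_of_ne (hnonneg x ⟨hx.1, hx.2.le⟩) fun h => ?_
  rcases hx.1.eq_or_lt with h0 | h0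
  · rw [← h0, hCD.apply_zero] at h
    norm_num at h
  · have hmin : IsLocalMin (C lam) x := by
      filter_upwards [Ioo_mem_nhds h0 hx.2] with z hz
      rw [← h]
      exact hnonneg z ⟨hz.1.le, hz.2.le⟩
    have h1 := hCD.deriv_neg_of_eq_zero hM h0
      (fun z hz => hnonneg z ⟨hz.1, hz.2.trans hx.2.le⟩) h.symm
    exact h1.ne (hmin.hasDerivAt_eq_zero (hCD.hasDerivAt_fst lam x))

/-- If the star has no negative eigenvalue, the Neumann solutions at the spectral parameter `0`
are positive on all the edges. -/
theorem neumannSolution_pos (hI : 0 < I) (ha : ∀ i, 0 < a i) (hq : ∀ i, Continuous (q i))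
    (hM : ∀ i x, |q i x| ≤ M) (hCD : ∀ i, IsNeumannSolution (q i) (C i) (D i))
    (hneg : ∀ lam < 0, ¬ IsStarEigenvalue a q lam) :
    ∀ i, ∀ x ∈ Icc 0 (a i), 0 < C i 0 x := by
  have hne : Nonempty (Fin I) := ⟨⟨0, hI⟩⟩
  set S : Set ℝ := {lam | ∀ i, ∀ x ∈ Icc 0 (a i), 0 < C i lam x} with hS
  have hSopen : IsOpen S := by
    simp only [hS, ofPred_forall]
    refine isOpen_iInter_of_finite fun i => isOpen_iff_mem_nhds.2 fun lam hlam => ?_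
    simp only [← ofPred_forall] at hlam ⊢
    exact isCompact_Icc.eventually_forall_of_forall_eventually fun x hx =>
      (hCD i).continuous_fst.continuousAt.eventually_const_lt (hlam x hx)
  have hlow : ∀ lam ≤ -M - 1, lam ∈ S ∧ ∀ i, 0 < D i lam (a i) := by
    intro lam hlam
    have h := fun i => neumannSolution_pos_of_one_le (r := fun x => q i x - lam)
      (fun x => by linarith [neg_abs_le (q i x), hM i x]) ((hCD i).apply_zero lam)
      ((hCD i).deriv_zero lam) ((hCD i).hasDerivAt_fst lam) ((hCD i).hasDerivAt_snd lam)
    exact ⟨fun i x hx => (h i).1 x hx.1, fun i => (h i).2 _ (ha i)⟩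
  set F : ℝ → ℝ := fun lam => ∑ i, D i lam (a i) / C i lam (a i) with hF
  have hCc : ∀ i x, Continuous fun lam => C i lam x := fun i x =>
    (hCD i).continuous_fst.comp (Continuous.prodMk_left x)
  have hDc : ∀ i x, Continuous fun lam => D i lam x := fun i x =>
    (hCD i).continuous_snd.comp (Continuous.prodMk_left x)
  have hCa : ∀ lam ∈ S, ∀ i, 0 < C i lam (a i) := fun lam h i => h i _ ⟨(ha i).le, le_rfl⟩
  have hFc : ContinuousOn F S := continuousOn_finsetSum _ fun i _ =>
    (hDc i _).continuousOn.div (hCc i _).continuousOn fun lam h => (hCa lam h i).ne'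
  by_contra hcon
  change (0 : ℝ) ∉ S at hcon
  set T : Set ℝ := Sᶜ ∩ Iic 0
  have hTne : T.Nonempty := ⟨0, hcon, mem_Iic.2 le_rfl⟩
  have hTbdd : BddBelow T := ⟨-M - 1, fun lam h => by
    by_contra hlt
    exact h.1 (hlow lam (not_le.1 hlt).le).1⟩
  have hTmem : sInf T ∈ T := (hSopen.isClosed_compl.inter isClosed_Iic).csInf_mem hTne hTbdd
  set μ := sInf T
  have hbelow : ∀ lam < μ, lam ∈ S := by
    intro lam h
    by_contra hlam
    exact (csInf_le hTbdd ⟨hlam, h.le.trans hTmem.2⟩).not_gt h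
  have hμlow : -M - 1 < μ := by
    by_contra h
    exact hTmem.1 (hlow μ (not_lt.1 h)).1
  have hFpos : ∀ lam < μ, 0 < F lam := by
    intro lam hlam
    by_contra hle
    have hstart : 0 < F (-M - 1) := Finset.sum_pos
      (fun i _ => div_pos ((hlow _ le_rfl).2 i) (hCa _ (hlow _ le_rfl).1 i)) Finset.univ_nonempty
    have hsub : uIcc (-M - 1) lam ⊆ Iio μ :=
      (convex_Iio μ).ordConnected.uIcc_subset hμlow hlam
    obtain ⟨z, hz, hz0⟩ := intermediate_value_uIcc
      (hFc.mono fun z hz => hbelow z (hsub hz))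
      (show (0 : ℝ) ∈ uIcc (F (-M - 1)) (F lam) from
        mem_uIcc.2 (Or.inr ⟨not_lt.1 hle, hstart.le⟩))
    have hzμ : z < μ := hsub hz
    exact hneg z (hzμ.trans_le hTmem.2) (isStarEigenvalue_of_sum_div_eq_zero hI ha hq hCD
      (fun i => (hCa z (hbelow z hzμ) i).ne') hz0)
  have hnonneg : ∀ i, ∀ x ∈ Icc 0 (a i), 0 ≤ C i μ x := by
    intro i x hx
    refine ge_of_tendsto (((hCc i x).tendsto μ).mono_left (nhdsWithin_le_nhds (s := Iio μ))) ?_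
    filter_upwards [self_mem_nhdsWithin] with lam hlam
    exact (hbelow lam hlam i x hx).le
  obtain ⟨i, hi⟩ : ∃ i, C i μ (a i) = 0 := by
    by_contra! h
    refine hTmem.1 fun i x hx => ?_
    rcases hx.2.eq_or_lt with hxa | hxa
    · rw [hxa]
      exact lt_of_le_of_ne (hnonneg i _ ⟨(ha i).le, le_rfl⟩) (h i).symm
    · exact (hCD i).pos_of_nonneg (hM i) (hnonneg i) ⟨hx.1, hxa⟩
  have hatBot : ∀ j, C j μ (a j) = 0 →
      Tendsto (fun lam => D j lam (a j) / C j lam (a j)) (𝓝[<] μ) atBot := by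
    intro j hj
    have h1 : Tendsto (fun lam => C j lam (a j)) (𝓝[<] μ) (𝓝[>] 0) := by
      refine tendsto_nhdsWithin_iff.2 ⟨?_, ?_⟩
      · rw [← hj]
        exact ((hCc j _).tendsto μ).mono_left nhdsWithin_le_nhds
      · filter_upwards [self_mem_nhdsWithin] with lam hlam
        exact hCa lam (hbelow lam hlam) j
    exact (((hDc j (a j)).tendsto μ).mono_left nhdsWithin_le_nhds).neg_mul_atTop
      ((hCD j).deriv_neg_of_eq_zero (hM j) (ha j) (hnonneg j) hj) h1.inv_tendsto_nhdsGT_zero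
  have hlim : Tendsto F (𝓝[<] μ) atBot := by
    refine tendsto_finset_sum_atBot (hatBot i hi) fun j => ?_
    by_cases hj : C j μ (a j) = 0
    · exact ⟨0, (hatBot j hj).eventually_le_atBot 0⟩
    · refine ⟨D j μ (a j) / C j μ (a j) + 1, ?_⟩
      have h1 : ContinuousAt (fun lam => D j lam (a j) / C j lam (a j)) μ :=
        (hDc j _).continuousAt.div (hCc j _).continuousAt hj
      exact nhdsWithin_le_nhds ((h1.eventually_lt_const (lt_add_one _)).mono fun _ h => h.le)
  obtain ⟨lam, h1, h2⟩ := ((hlim.eventually_le_atBot 0).and self_mem_nhdsWithin).exists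
  exact (hFpos lam h2).not_ge h1

/-- If the lowest eigenvalue of the star is `0` and the mean of the potential vanishes, then so
does the potential. -/
theorem potential_eq_zero_of_sum_integral (hI : 0 < I) (ha : ∀ i, 0 < a i)
    (hq : ∀ i, Continuous (q i)) (hM : ∀ i x, |q i x| ≤ M)
    (hneg : ∀ lam < 0, ¬ IsStarEigenvalue a q lam) (hzero : IsStarEigenvalue a q 0)
    (hint : ∑ i, ∫ x in (0 : ℝ)..a i, q i x = 0) :
    ∀ i, ∀ x ∈ Icc 0 (a i), q i x = 0 := by
  choose C D hCD using fun i => exists_isNeumannSolution (hq i) (hM i)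
  have hpos := neumannSolution_pos hI ha hq hM hCD hneg
  have hCpos : ∀ i, 0 < C i 0 (a i) := fun i => hpos i _ ⟨(ha i).le, le_rfl⟩
  have hC := fun i => (hCD i).hasDerivAt_fst 0
  have hD : ∀ i x, HasDerivAt (D i 0) (q i x * C i 0 x) x := fun i x => by
    simpa using (hCD i).hasDerivAt_snd 0 x
  have hsum : ∑ i, D i 0 (a i) / C i 0 (a i) = 0 := by
    obtain ⟨y, y', y'', hy, hy', -, ⟨i₀, x₀, hx₀, hne⟩, hode, h0, hcont, hk⟩ := hzero
    have hwron : ∀ i, ∀ x ∈ Icc 0 (a i), y' i x * C i 0 x = y i x * D i 0 x := by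
      intro i x hx
      have hd : ∀ x ∈ Icc 0 (a i),
          HasDerivAt (fun x => y' i x * C i 0 x - y i x * D i 0 x) 0 x := fun x hx => by
        refine (((hy' i x hx).mul (hC i x)).sub ((hy i x hx).mul (hD i x))).congr_deriv ?_
        have : y'' i x = q i x * y i x := by linarith [hode i x hx]
        rw [this]; ring
      have h1 := constant_of_has_deriv_right_zero
        (fun x hx => (hd x hx).continuousAt.continuousWithinAt)
        (fun x hx => (hd x (Ico_subset_Icc_self hx)).hasDerivWithinAt) x hx
      simp only [h0, (hCD i).deriv_zero, zero_mul, mul_zero, sub_zero] at h1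
      linarith
    have hquot : ∀ i, ∀ x ∈ Icc 0 (a i), y i x = y i 0 * C i 0 x := by
      intro i x hx
      have hd : ∀ x ∈ Icc 0 (a i), HasDerivAt (fun x => y i x / C i 0 x) 0 x := fun x hx => by
        refine ((hy i x hx).div (hC i x) (hpos i x hx).ne').congr_deriv ?_
        rw [hwron i x hx, sub_self, zero_div]
      have h1 := constant_of_has_deriv_right_zero
        (fun x hx => (hd x hx).continuousAt.continuousWithinAt)
        (fun x hx => (hd x (Ico_subset_Icc_self hx)).hasDerivWithinAt) x hx
      simp only [(hCD i).apply_zero, div_one] at h1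
      rw [← h1, div_mul_cancel₀ _ (hpos i x hx).ne']
    have hY : y i₀ (a i₀) ≠ 0 := by
      intro h
      rw [hquot i₀ _ ⟨(ha i₀).le, le_rfl⟩, mul_eq_zero] at h
      rw [hquot i₀ _ hx₀] at hne
      exact hne (by rw [h.resolve_right (hCpos i₀).ne', zero_mul])
    have h1 : ∀ i, y' i (a i) = y i₀ (a i₀) * (D i 0 (a i) / C i 0 (a i)) := fun i => by
      rw [hcont i₀ i, ← mul_div_assoc, ← hwron i _ ⟨(ha i).le, le_rfl⟩,
        mul_div_cancel_right₀ _ (hCpos i).ne']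
    simp_rw [h1, ← Finset.mul_sum] at hk
    exact (mul_eq_zero.1 hk).resolve_left hY
  let R : Fin I → ℝ → ℝ := fun i x => (∫ t in (0 : ℝ)..x, q i t) - D i 0 x / C i 0 x
  have hR : ∀ i, ∀ x ∈ Icc 0 (a i), HasDerivAt (R i) ((D i 0 x / C i 0 x) ^ 2) x := by
    intro i x hx
    have h1 := intervalIntegral.integral_hasDerivAt_right ((hq i).intervalIntegrable 0 x)
      ((hq i).stronglyMeasurableAtFilter _ _) (hq i).continuousAt
    refine (h1.sub ((hD i x).div (hC i x) (hpos i x hx).ne')).congr_deriv ?_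
    have := (hpos i x hx).ne'
    field_simp
    ring
  have hmono : ∀ i, MonotoneOn (R i) (Icc 0 (a i)) := fun i =>
    monotoneOn_of_hasDerivWithinAt_nonneg (convex_Icc _ _)
      (fun x hx => (hR i x hx).continuousAt.continuousWithinAt)
      (fun x hx => (hR i x (interior_subset hx)).hasDerivWithinAt) fun x _ => sq_nonneg _
  have hR0 : ∀ i, R i 0 = 0 := fun i => by simp [R, (hCD i).deriv_zero]
  have hRa : ∀ i, 0 ≤ R i (a i) := fun i => by
    simpa [hR0] using hmono i ⟨le_rfl, (ha i).le⟩ ⟨(ha i).le, le_rfl⟩ (ha i).le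
  have hRsum : ∑ i, R i (a i) = 0 := by
    simp only [R, Finset.sum_sub_distrib, hint, hsum, sub_zero]
  intro i
  have hRa0 : R i (a i) = 0 :=
    (Finset.sum_eq_zero_iff_of_nonneg fun i _ => hRa i).1 hRsum i (Finset.mem_univ i)
  have hRzero : ∀ x ∈ Icc 0 (a i), R i x = 0 := fun x hx => by
    have h1 := hmono i ⟨le_rfl, (ha i).le⟩ hx hx.1
    have h2 := hmono i hx ⟨(ha i).le, le_rfl⟩ hx.2
    rw [hR0] at h1
    rw [hRa0] at h2
    exact le_antisymm h2 h1
  have hDzero : ∀ x ∈ Icc 0 (a i), D i 0 x = 0 := fun x hx => by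
    have h1 := (uniqueDiffOn_Icc (ha i) x hx).eq_deriv _ (hR i x hx).hasDerivWithinAt
      ((hasDerivWithinAt_const x _ (0 : ℝ)).congr hRzero (hRzero x hx))
    have h2 := pow_eq_zero_iff (two_ne_zero) |>.1 h1
    exact (div_eq_zero_iff.1 h2).resolve_right (hpos i x hx).ne'
  intro x hx
  have h1 := (uniqueDiffOn_Icc (ha i) x hx).eq_deriv _ (hD i x).hasDerivWithinAt
    ((hasDerivWithinAt_const x _ (0 : ℝ)).congr hDzero (hDzero x hx))
  exact (mul_eq_zero.1 h1).resolve_right (hpos i x hx).ne'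

end GroundState

section Ambarzumyan

open Real

variable {I : ℕ} {a : Fin I → ℝ}

theorem isStarEigenvalue_congr {p q : Fin I → ℝ → ℝ} {lam : ℝ}
    (h : ∀ i, ∀ x ∈ Icc 0 (a i), p i x = q i x) :
    IsStarEigenvalue a p lam ↔ IsStarEigenvalue a q lam := by
  have hode : ∀ y y'' : Fin I → ℝ → ℝ,
      (∀ i, ∀ x ∈ Icc 0 (a i), -(y'' i x) + p i x * y i x = lam * y i x) ↔
        ∀ i, ∀ x ∈ Icc 0 (a i), -(y'' i x) + q i x * y i x = lam * y i x := fun y y'' =>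
    forall₃_congr fun i x hx => by rw [h i x hx]
  simp only [IsStarEigenvalue, hode]

/-- At a frequency with no edge in Dirichlet resonance, an eigenfunction close to the free ones
does not vanish at the interior vertex, and can be normalised to be `1` there. -/
theorem IsStarEigenvalue.exists_normalised {q : Fin I → ℝ → ℝ} (ha : ∀ i, 0 < a i)
    (hq : ∀ i, Continuous (q i)) {M : ℝ} (hM : ∀ i x, |q i x| ≤ M) {k : ℝ} (hk : 0 < k)
    (hkM : ∀ i, 8 * M * a i ≤ k) (hcos : ∀ i, 1 / 4 < cos (k * a i) ^ 2)
    (h : IsStarEigenvalue a q (k ^ 2)) :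
    ∃ y y' y'' : Fin I → ℝ → ℝ,
      (∀ i, ∀ x ∈ Icc 0 (a i), HasDerivAt (y i) (y' i x) x) ∧
      (∀ i, ∀ x ∈ Icc 0 (a i), HasDerivAt (y' i) (y'' i x) x) ∧
      (∀ i, ∀ x ∈ Icc 0 (a i), y'' i x = (q i x - k ^ 2) * y i x) ∧
      (∀ i, y' i 0 = 0) ∧ (∀ i, y i (a i) = 1) ∧ ∑ i, y' i (a i) = 0 := by
  obtain ⟨y, y', y'', hy, hy', -, ⟨i₀, x₀, hx₀, hne⟩, hode, h0, hcont, hsum⟩ := h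
  have hM0 : 0 ≤ M := (abs_nonneg _).trans (hM i₀ 0)
  have hode' : ∀ i, ∀ x ∈ Icc 0 (a i), y'' i x = (q i x - k ^ 2) * y i x := fun i x hx => by
    linarith [hode i x hx]
  have hclose : ∀ x ∈ Icc 0 (a i₀), |y i₀ x - y i₀ 0 * cos (k * x)| ≤
      2 * M * a i₀ * |y i₀ 0| / k := fun x hx =>
    abs_sub_cos_le (hq i₀) (hM i₀) hk
      (by linarith [hkM i₀, mul_nonneg hM0 (ha i₀).le]) (hy i₀) (hy' i₀) (hode' i₀) (h0 i₀) hx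
  have hY : y i₀ (a i₀) ≠ 0 := by
    intro hzero
    have h1 := hclose (a i₀) ⟨(ha i₀).le, le_rfl⟩
    rw [hzero, zero_sub, abs_neg, abs_mul, le_div_iff₀ hk] at h1
    have h2 : 1 / 2 < |cos (k * a i₀)| := by
      rw [← abs_of_pos (one_half_pos (α := ℝ))]
      exact sq_lt_sq.1 (by linarith [hcos i₀])
    have hinit : y i₀ 0 = 0 := by
      by_contra hne0
      have h3 : 0 < |y i₀ 0| := abs_pos.2 hne0
      have h4 : |y i₀ 0| * (1 / 2) * k < |y i₀ 0| * |cos (k * a i₀)| * k := by gcongr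
      have h5 := mul_le_mul_of_nonneg_right (hkM i₀) h3.le
      have h6 := mul_pos h3 hk
      linarith
    have h7 := hclose x₀ hx₀
    rw [hinit] at h7
    simp only [zero_mul, sub_zero, abs_zero, mul_zero, zero_div] at h7
    exact hne (abs_nonpos_iff.1 h7)
  refine ⟨fun i x => y i x / y i₀ (a i₀), fun i x => y' i x / y i₀ (a i₀),
    fun i x => y'' i x / y i₀ (a i₀), ?_, ?_, ?_, ?_, ?_, ?_⟩
  · exact fun i x hx => (hy i x hx).div_const _
  · exact fun i x hx => (hy' i x hx).div_const _
  · intro i x hx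
    simp only [hode' i x hx, mul_div_assoc]
  · intro i
    simp only [h0, zero_div]
  · intro i
    simp only [hcont i i₀, div_self hY]
  · rw [← Finset.sum_div, hsum, zero_div]

/-- If every free eigenvalue is an eigenvalue for the potential, the potential has mean zero. -/
theorem sum_integral_eq_zero_of_isStarEigenvalue {q : Fin I → ℝ → ℝ} (hI : 0 < I)
    (ha : ∀ i, 0 < a i) (hq : ∀ i, Continuous (q i)) {M : ℝ} (hM : ∀ i x, |q i x| ≤ M)
    (h : ∀ k : ℝ, IsStarEigenvalue a (fun _ _ => 0) (k ^ 2) → IsStarEigenvalue a q (k ^ 2)) :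
    ∑ i, ∫ x in (0 : ℝ)..a i, q i x = 0 := by
  have hM0 : 0 ≤ M := (abs_nonneg _).trans (hM ⟨0, hI⟩ 0)
  have hL : ∀ i, a i ≤ ∑ j, a j := fun i =>
    Finset.single_le_sum (fun j _ => (ha j).le) (Finset.mem_univ i)
  have hη : ∀ n : ℕ, (1 : ℝ) / (n + 2) ≤ 1 / 2 := fun n =>
    one_div_le_one_div_of_le (by norm_num) (by linarith [n.cast_nonneg (α := ℝ)])
  choose k hkT hktan hkcos using fun n : ℕ =>
    exists_resonant_frequency hI ha (η := 1 / (n + 2)) (by positivity)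
      ((hη n).trans (by norm_num)) (max (n + 1) (8 * M * ∑ j, a j))
  have hcos : ∀ n i, 1 / 4 < cos (k n * a i) ^ 2 := fun n i => by
    have h1 : ((1 : ℝ) / (n + 2)) ^ 2 ≤ (1 / 2) ^ 2 :=
      pow_le_pow_left₀ (by positivity) (hη n) 2
    linarith [hkcos n i]
  have hkpos : ∀ n, 0 < k n := fun n => by
    have := (le_max_left _ _).trans (hkT n)
    linarith [n.cast_nonneg (α := ℝ)]
  have hkM : ∀ n i, 8 * M * a i ≤ k n := fun n i =>
    (mul_le_mul_of_nonneg_left (hL i) (by positivity)).trans ((le_max_right _ _).trans (hkT n))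
  have hk : Tendsto k atTop atTop := tendsto_atTop_mono
    (fun n => by linarith [(le_max_left _ _).trans (hkT n)]) tendsto_natCast_atTop_atTop
  have hcosne : ∀ n i, cos (k n * a i) ≠ 0 := fun n i h0 => by
    have := hcos n i
    rw [h0] at this
    norm_num at this
  have hcoslim : ∀ i, Tendsto (fun n => cos (k n * a i) ^ 2) atTop (𝓝 1) := by
    intro i
    have h1 : Tendsto (fun n : ℕ => (1 : ℝ) / (n + 2)) atTop (𝓝 0) :=
      tendsto_const_nhds.div_atTop (tendsto_atTop_add_const_right _ _ tendsto_natCast_atTop_atTop)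
    refine tendsto_of_tendsto_of_tendsto_of_le_of_le (g := fun n : ℕ => 1 - ((1 : ℝ) / (n + 2)) ^ 2)
      (by simpa using (h1.pow 2).const_sub 1) tendsto_const_nhds (fun n => hkcos n i)
      fun n => cos_sq_le_one _
  choose y y' y'' hy hy' hode h0 h1 hsum using fun n =>
    (h (k n) (isStarEigenvalue_zero_of_sum_tan hI ha (hktan n) (hcosne n))).exists_normalised
      ha hq hM (hkpos n) (hkM n) (hcos n)
  have hlim : Tendsto (fun n => ∑ i, (y' n i (a i) + k n * tan (k n * a i))) atTop
      (𝓝 (∑ i, 1 / 2 * ∫ x in (0 : ℝ)..a i, q i x)) :=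
    tendsto_finsetSum _ fun i _ => tendsto_deriv_add_mul_tan (hq i) (hM i) (ha i).le hk
      (hcoslim i) (fun n => hy n i) (fun n => hy' n i) (fun n => hode n i) (fun n => h0 n i)
      fun n => h1 n i
  simp only [Finset.sum_add_distrib, hsum, ← Finset.mul_sum, hktan, mul_zero, add_zero] at hlim
  linarith [tendsto_nhds_unique hlim tendsto_const_nhds]

end Ambarzumyan

/-- Ambarzumyan theorem for star-shaped trees: if the spectrum of the Neumann
star problem for (continuous) potentials `Q = (q₁, …, q_I)` equals the spectrum
for the zero potentials, then every `qᵢ` vanishes on `[0, aᵢ]`. -/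
theorem ambarzumyan_star
    (I : ℕ) (hI : 2 ≤ I) (a : Fin I → ℝ) (ha : ∀ i, 0 < a i)
    (q : Fin I → ℝ → ℝ) (hq : ∀ i, ContinuousOn (q i) (Set.Icc 0 (a i)))
    (hspec : {lam : ℝ | IsStarEigenvalue a q lam} =
             {lam : ℝ | IsStarEigenvalue a (fun _ _ => 0) lam}) :
    ∀ i, ∀ x ∈ Set.Icc (0 : ℝ) (a i), q i x = 0 := by
  have hI0 : 0 < I := by omega
  let Q : Fin I → ℝ → ℝ := fun i => IccExtend (ha i).le (domRestrict (Icc 0 (a i)) (q i))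
  have hQq : ∀ i, ∀ x ∈ Icc 0 (a i), q i x = Q i x := fun i x hx =>
    (IccExtend_of_mem (ha i).le (domRestrict (Icc 0 (a i)) (q i)) hx).symm
  have hQc : ∀ i, Continuous (Q i) := fun i => (hq i).domRestrict.Icc_extend'
  have hQb : ∀ i, ∃ M, ∀ x, |Q i x| ≤ M := fun i => by
    obtain ⟨M, hM⟩ := isCompact_Icc.exists_bound_of_continuousOn (hq i)
    exact ⟨M, fun x => hM _ (projIcc 0 (a i) (ha i).le x).2⟩
  choose M hM using hQb
  have hMsum : ∀ i x, |Q i x| ≤ ∑ j, M j := fun i x => (hM i x).trans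
    (Finset.single_le_sum (fun j _ => (abs_nonneg _).trans (hM j 0)) (Finset.mem_univ i))
  have hspecQ : ∀ lam, IsStarEigenvalue a Q lam ↔ IsStarEigenvalue a (fun _ _ => 0) lam :=
    fun lam => (isStarEigenvalue_congr hQq).symm.trans (Set.ext_iff.1 hspec lam)
  intro i x hx
  rw [hQq i x hx]
  exact potential_eq_zero_of_sum_integral hI0 ha hQc hMsum
    (fun lam hlam h => not_isStarEigenvalue_zero_of_neg ha hlam ((hspecQ lam).1 h))
    ((hspecQ 0).2 (isStarEigenvalue_zero_zero hI0 ha))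
    (sum_integral_eq_zero_of_isStarEigenvalue hI0 ha hQc hMsum
      fun k h => (hspecQ _).2 h) i x hx
end
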